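/- arXiv:1403.2880 — 3 statements merged into one kernel-verified Lean document; each statement's English description precedes it below -/
import Mathlib

section
/- Let q be a power of two and let f ∈ F_q[x] have positive even degree that is neither equal to 6 nor a power of two. Then Φ_f has an absolutely irreducible factor over F_q. -/
/-- The denominator `(x+y)(x+z)(y+z)` as a polynomial in the variables
`x = X 0`, `y = X 1`, `z = X 2`. -/
noncomputable def denom (F : Type*) [Field F] : MvPolynomial (Fin 3) F :=
  (MvPolynomial.X 0 + MvPolynomial.X 1) * (MvPolynomial.X 0 + MvPolynomial.X 2) *
    (MvPolynomial.X 1 + MvPolynomial.X 2)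

/-- The numerator `x(f(y)+f(z)) + y(f(x)+f(z)) + z(f(x)+f(y))` of `Φ_f`;
`Φ_f` is the (exact) quotient of `numer F f` by `denom F`. -/
noncomputable def numer (F : Type*) [Field F] (f : Polynomial F) : MvPolynomial (Fin 3) F :=
  MvPolynomial.X 0 *
      (Polynomial.aeval (MvPolynomial.X 1) f + Polynomial.aeval (MvPolynomial.X 2) f) +
    MvPolynomial.X 1 *
      (Polynomial.aeval (MvPolynomial.X 0) f + Polynomial.aeval (MvPolynomial.X 2) f) +
    MvPolynomial.X 2 *
      (Polynomial.aeval (MvPolynomial.X 0) f + Polynomial.aeval (MvPolynomial.X 1) f)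

/-- The numerator `x(y^j+z^j) + y(x^j+z^j) + z(x^j+y^j)` of `φ_j`;
`φ_j` is the (exact) quotient of `numerMon F j` by `denom F`. -/
noncomputable def numerMon (F : Type*) [Field F] (j : ℕ) : MvPolynomial (Fin 3) F :=
  MvPolynomial.X 0 * (MvPolynomial.X 1 ^ j + MvPolynomial.X 2 ^ j) +
    MvPolynomial.X 1 * (MvPolynomial.X 0 ^ j + MvPolynomial.X 2 ^ j) +
    MvPolynomial.X 2 * (MvPolynomial.X 0 ^ j + MvPolynomial.X 1 ^ j)

/-- A polynomial over `F` has an absolutely irreducible factor over `F` if it has a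
nonconstant factor with coefficients in `F` that stays irreducible over the algebraic
closure of `F`. -/
def HasAbsIrredFactor (F : Type*) [Field F] (P : MvPolynomial (Fin 3) F) : Prop :=
  ∃ g : MvPolynomial (Fin 3) F, g ∣ P ∧ 0 < g.totalDegree ∧
    Irreducible (MvPolynomial.map (algebraMap F (AlgebraicClosure F)) g)

section
namespace PhiAux
open Polynomial Polynomial.Bivariate

section basics
variable {k : Type*} [Field k]

/-- `E(t,V) = V((1+t)^l+t^l) + (V^n+t)^l+t^l`, with `V = C X`, `t = Y`. -/
noncomputable def EE (k : Type*) [Field k] (l n : ℕ) : k[X][Y] :=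
  C X * ((1 + Y) ^ l + Y ^ l) + (C X ^ n + Y) ^ l + Y ^ l

/-- The quotient of `E` by `V(V+1)`. -/
noncomputable def HH (k : Type*) [Field k] (l n : ℕ) : k[X][Y] :=
  ∑ i ∈ Finset.range l, Y ^ (l - 1 - i) *
    C ((l.choose (i + 1) : k[X]) * ∑ r ∈ Finset.range (n * (i + 1) - 1), X ^ r)

lemma two_zero {S : Type*} [CommRing S] [Algebra k S] [CharP k 2] : (2 : S) = 0 := by
  have : (2 : k) = 0 := CharTwo.two_eq_zero
  calc (2 : S) = algebraMap k S 2 := (map_ofNat _ 2).symm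
    _ = 0 := by rw [this, map_zero]

lemma HE [CharP k 2] (l n : ℕ) (hn : 1 ≤ n) :
    C (X ^ 2 + X) * HH k l n = EE k l n := by
  have h2 : (2 : k[X][Y]) = 0 := two_zero (k := k)
  have h2' : (2 : k[X]) = 0 := two_zero (k := k)
  unfold EE HH
  rw [add_pow, add_pow, Finset.sum_range_succ', Finset.sum_range_succ', Finset.mul_sum]
  simp only [pow_zero, one_pow, one_mul, Nat.choose_zero_right, Nat.cast_one, mul_one, Nat.sub_zero]
  have key : ∀ i ∈ Finset.range l, C (X ^ 2 + X) * (Y ^ (l - 1 - i) *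
      C ((l.choose (i + 1) : k[X]) * ∑ r ∈ Finset.range (n * (i + 1) - 1), X ^ r))
      = C X * (Y ^ (l - (i + 1)) * (l.choose (i+1) : k[X][Y])) +
        (C X ^ n) ^ (i + 1) * Y ^ (l - (i + 1)) * (l.choose (i+1) : k[X][Y]) := by
    intro i hi
    have e : l - 1 - i = l - (i + 1) := by omega
    have hg : (X ^ 2 + X : k[X]) * ∑ r ∈ Finset.range (n * (i + 1) - 1), X ^ r
        = X + (X ^ n) ^ (i+1) := by
      have h1 := mul_geom_sum (X : k[X]) (n * (i + 1) - 1)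
      have h3 : X * (X : k[X]) ^ (n * (i + 1) - 1) = (X ^ n) ^ (i+1) := by
        rw [← pow_mul, ← pow_succ']
        congr 1
        have : 1 ≤ n * (i + 1) := Nat.mul_pos hn (by omega)
        omega
      linear_combination X * h1 + h3 + (X * (∑ r ∈ Finset.range (n * (i + 1) - 1), X ^ r) - X) * h2'
    have hg' := congrArg (C : k[X] → k[X][Y]) hg
    simp only [map_mul, map_add, map_pow, map_natCast] at hg' ⊢
    rw [e]
    linear_combination Y ^ (l - (i + 1)) * (l.choose (i+1) : k[X][Y]) * hg'
  rw [Finset.sum_congr rfl key, Finset.sum_add_distrib, ← Finset.mul_sum]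
  linear_combination (-(C X * Y ^ l) - Y ^ l) * h2

/-- derivative in the inner variable. -/
noncomputable def dV (f : k[X][Y]) : k[X][Y] := swap (derivative (swap f))

lemma dV_add (f g : k[X][Y]) : dV (f + g) = dV f + dV g := by simp [dV]
lemma dV_mul (f g : k[X][Y]) : dV (f * g) = dV f * g + f * dV g := by
  simp only [dV, map_mul, derivative_mul, map_add, Bivariate.swap_swap_apply]
lemma dV_C (f : k[X]) : dV (C f) = C (derivative f) := by
  simp only [dV, Bivariate.swap_C, derivative_map, Bivariate.swap_map_C]
lemma dV_Y : dV (Y : k[X][Y]) = 0 := by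
  rw [dV, Bivariate.swap_Y, derivative_C, map_zero]
lemma dV_one : dV (1 : k[X][Y]) = 0 := by
  simp [dV]
lemma dV_pow (f : k[X][Y]) (n : ℕ) : dV (f ^ n) = n * f ^ (n - 1) * dV f := by
  simp only [dV, map_pow, derivative_pow, map_mul, Bivariate.swap_swap_apply]
  simp
lemma dV_pow_eq_zero {f : k[X][Y]} (h : dV f = 0) (n : ℕ) : dV (f ^ n) = 0 := by
  rw [dV_pow, h, mul_zero]

variable [CharP k 2]

lemma dV_pow_even (f : k[X][Y]) {n : ℕ} (h : Even n) : dV (f ^ n) = 0 := by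
  obtain ⟨m, rfl⟩ := h
  have h2 : (2 : k[X][Y]) = 0 := two_zero (k := k)
  rw [dV_pow]; push_cast
  linear_combination (m * f ^ (m + m - 1) * dV f) * h2

lemma dV_EE (l : ℕ) {n : ℕ} (h : Even n) : dV (EE k l n) = (1 + Y) ^ l + Y ^ l := by
  have hY : ∀ m, dV (Y ^ m : k[X][Y]) = 0 := fun m => dV_pow_eq_zero dV_Y m
  have h1 : dV ((1 + Y) ^ l : k[X][Y]) = 0 := dV_pow_eq_zero (by rw [dV_add, dV_one, dV_Y, add_zero]) l
  have h3 : dV ((C X ^ n + Y) ^ l : k[X][Y]) = 0 :=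
    dV_pow_eq_zero (by rw [dV_add, dV_pow_even _ h, dV_Y, add_zero]) l
  simp [EE, dV_add, dV_mul, hY, h1, h3, dV_C]

lemma natCast_odd {S : Type*} [CommRing S] [Algebra k S] {l : ℕ} (h : Odd l) : (l : S) = 1 := by
  obtain ⟨m, rfl⟩ := h
  have h2 : (2 : S) = 0 := two_zero (k := k)
  push_cast; linear_combination m * h2

lemma dt_EE {l : ℕ} (hl : Odd l) (n : ℕ) : derivative (EE k l n) =
    C X * ((1 + Y) ^ (l-1) + Y ^ (l-1)) + (C X ^ n + Y) ^ (l-1) + Y ^ (l-1) := by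
  have h3 : derivative (C X ^ n : k[X][Y]) = 0 := by rw [← C_pow, derivative_C]
  simp [EE, derivative_pow, h3, derivative_mul, natCast_odd (k := k) hl]

/-- Main facts at a point where `H` vanishes to second order. -/
lemma dVH {l n : ℕ} (hn : 1 ≤ n) (he : Even n) :
    C (X ^ 2 + X) * dV (HH k l n) + HH k l n = (1 + Y) ^ l + Y ^ l := by
  have h2 : (2 : k[X]) = 0 := two_zero (k := k)
  rw [← dV_EE l he, ← HE l n hn, dV_mul, dV_C]
  have : derivative (X ^ 2 + X : k[X]) = 1 := by
    rw [derivative_add, derivative_pow, derivative_X]; push_cast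
    simp only [C_ofNat, h2]; ring
  rw [this]; simp; ring

end basics
end PhiAux
end

section
namespace PhiAux
open Polynomial Polynomial.Bivariate

section nodes
variable {k : Type*} [Field k]

lemma exists_point [IsAlgClosed k] (M : Ideal k[X][Y]) [hM : M.IsMaximal] :
    ∃ v t : k, ∀ g ∈ M, g.evalEval v t = 0 := by
  letI : Field (k[X][Y] ⧸ M) := Ideal.Quotient.field M
  haveI : Module.Finite k (k[X][Y] ⧸ M) := finite_of_finite_type_of_isJacobsonRing k _
  have hb := IsAlgClosed.algebraMap_bijective_of_isIntegral (k := k) (K := k[X][Y] ⧸ M)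
  let e : k ≃ₐ[k] (k[X][Y] ⧸ M) := AlgEquiv.ofBijective (Algebra.ofId k _) hb
  let φ : k[X][Y] →ₐ[k] k := (e.symm : (k[X][Y] ⧸ M) →ₐ[k] k).comp (Ideal.Quotient.mkₐ k M)
  refine ⟨φ (C X), φ Y, fun g hg => ?_⟩
  have h1 : φ g = 0 := by
    have : Ideal.Quotient.mk M g = 0 := Ideal.Quotient.eq_zero_iff_mem.2 hg
    simp [φ, this]
  have h2 : φ = aevalAeval (φ (C X)) (φ Y) := by
    ext <;> simp
  rw [← coe_aevalAeval_eq_evalEval, ← h2, h1]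

lemma decomp {f : k[X][Y]} {v t : k} (h : f.evalEval v t = 0) :
    ∃ g1 g2, f = C (X - C v) * g1 + (Y - C (C t)) * g2 := by
  obtain ⟨q, hq⟩ := X_sub_C_dvd_sub_C_eval (a := (C t : k[X])) (p := f)
  have hr : (f.eval (C t)).IsRoot v := h
  obtain ⟨s, hs⟩ := dvd_iff_isRoot.2 hr
  refine ⟨C s, q, ?_⟩
  rw [← C_mul, ← hs, ← hq]; ring

lemma exists_colon {R : Type*} [CommRing R] (I : Ideal R) (f : R) :
    ∃ J : Ideal R, ∀ r, r ∈ J ↔ r * f ∈ I :=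
  ⟨Submodule.comap (LinearMap.mulRight R f) I, fun r => by simp⟩

lemma mem_of_vanish [IsAlgClosed k] (I : Ideal k[X][Y])
    (hI : ∀ v t : k, (∀ g ∈ I, g.evalEval v t = 0) →
      ∃ r : k[X][Y], r.evalEval v t ≠ 0 ∧ r * C (X - C v) ∈ I ∧ r * (Y - C (C t)) ∈ I)
    (f : k[X][Y]) (hf : ∀ v t : k, (∀ g ∈ I, g.evalEval v t = 0) → f.evalEval v t = 0) : f ∈ I := by
  by_contra hfI
  obtain ⟨J, hJf⟩ := exists_colon I f
  have hJ : J ≠ ⊤ := fun h => hfI (by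
    have : (1 : k[X][Y]) ∈ J := h ▸ Submodule.mem_top
    rwa [hJf, one_mul] at this)
  obtain ⟨M, hM, hJM⟩ := Ideal.exists_le_maximal J hJ
  obtain ⟨v, t, hp⟩ := exists_point M
  have hIJ : I ≤ J := fun g hg => (hJf g).2 (I.mul_mem_right f hg)
  have hz : ∀ g ∈ I, g.evalEval v t = 0 := fun g hg => hp g (hJM (hIJ hg))
  obtain ⟨r, hr0, hr1, hr2⟩ := hI v t hz
  obtain ⟨g1, g2, hfg⟩ := decomp (hf v t hz)
  apply hr0
  apply hp r (hJM _)
  rw [hJf]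
  have : r * f = (r * C (X - C v)) * g1 + (r * (Y - C (C t))) * g2 := by
    rw [hfg]; ring
  rw [this]
  exact I.add_mem (I.mul_mem_right _ hr1) (I.mul_mem_right _ hr2)

variable [CharP k 2]

/-- all facts at a common zero of complementary factors of `H`. -/
lemma node {l n : ℕ} (hl : Odd l) (hn : 1 ≤ n) (he : Even n) {A B : k[X][Y]} (hAB : A * B = HH k l n)
    {v t : k} (hA : A.evalEval v t = 0) (hB : B.evalEval v t = 0) :
    (1 + t) ^ l + t ^ l = 0 ∧
    v * ((1 + t) ^ (l-1) + t ^ (l-1)) + (v ^ n + t) ^ (l-1) + t ^ (l-1) = 0 ∧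
    (v ^ n + t) ^ l + t ^ l = 0 ∧
    ∃ r : k[X][Y], r.evalEval v t * (v ^ 2 + v) = (1 + t) ^ (l-1) + t ^ (l-1) ∧
      r * C (X - C v) ∈ Ideal.span {A, B} ∧ r * (Y - C (C t)) ∈ Ideal.span {A, B} := by
  obtain ⟨a1, a2, ha⟩ := decomp hA
  obtain ⟨b1, b2, hb⟩ := decomp hB
  have h2 : (2 : k[X][Y]) = 0 := two_zero (k := k)
  have h2k : (2 : k) = 0 := CharTwo.two_eq_zero
  have hH0 : (HH k l n).evalEval v t = 0 := by rw [← hAB, evalEval_mul, hA, zero_mul]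
  have hHV : (dV (HH k l n)).evalEval v t = 0 := by
    rw [← hAB, dV_mul, evalEval_add, evalEval_mul, evalEval_mul, hA, hB]; ring
  have hHt : (derivative (HH k l n)).evalEval v t = 0 := by
    rw [← hAB, derivative_mul, evalEval_add, evalEval_mul, evalEval_mul, hA, hB]; ring
  have hdu : dV (C (X - C v) : k[X][Y]) = 1 := by rw [dV_C]; simp
  have hdw : dV (Y - C (C t) : k[X][Y]) = 0 := by
    rw [sub_eq_add_neg, ← C_neg, ← C_neg, dV_add, dV_Y, dV_C]; simp
  have hAV : (dV A).evalEval v t = a1.evalEval v t := by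
    rw [ha, dV_add, dV_mul, dV_mul, hdu, hdw]; simp [evalEval_C]
  have hBV : (dV B).evalEval v t = b1.evalEval v t := by
    rw [hb, dV_add, dV_mul, dV_mul, hdu, hdw]; simp [evalEval_C]
  have hAt : (derivative A).evalEval v t = a2.evalEval v t := by
    rw [ha, derivative_add, derivative_mul, derivative_mul]; simp [evalEval_C]
  have hBt : (derivative B).evalEval v t = b2.evalEval v t := by
    rw [hb, derivative_add, derivative_mul, derivative_mul]; simp [evalEval_C]
  have hHtV : (derivative (dV (HH k l n))).evalEval v t = (a1 * b2 + a2 * b1).evalEval v t := by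
    rw [← hAB, dV_mul, derivative_add, derivative_mul, derivative_mul]
    simp only [evalEval_add, evalEval_mul, hAV, hBV, hAt, hBt, hA, hB]; ring
  have e1 := dVH (k := k) (l := l) hn he
  have e2 := congrArg derivative e1
  have e3 := congrArg derivative (HE (k := k) l n hn)
  rw [dt_EE hl] at e3
  have e4 := HE (k := k) l n hn
  unfold EE at e4
  replace e1 := congrArg (evalEval v t) e1
  replace e2 := congrArg (evalEval v t) e2
  replace e3 := congrArg (evalEval v t) e3
  replace e4 := congrArg (evalEval v t) e4
  have hlk : (l : k) = 1 := natCast_odd (k := k) hl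
  simp only [derivative_mul, derivative_add, derivative_pow, derivative_C, derivative_X, derivative_one,
    evalEval_add, evalEval_mul, evalEval_pow, evalEval_C, evalEval_X, evalEval_one, eval_X, eval_add, eval_pow, evalEval_zero,
    hH0, hHV, hHt, hHtV, map_natCast, evalEval_natCast, hlk] at e1 e2 e3 e4
  have f1 : (1 + t) ^ l + t ^ l = 0 := by linear_combination -e1
  refine ⟨f1, by linear_combination -e3, by linear_combination -e4 - v * f1, a1 * b2 + a2 * b1, ?_, ?_, ?_⟩
  · simp only [evalEval_add, evalEval_mul]; linear_combination e2
  · rw [Ideal.mem_span_pair]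
    refine ⟨b2, a2, ?_⟩
    rw [ha, hb]; linear_combination (Y - C (C t)) * a2 * b2 * h2
  · rw [Ideal.mem_span_pair]
    refine ⟨b1, a1, ?_⟩
    rw [ha, hb]; linear_combination (C (X - C v)) * a1 * b1 * h2

end nodes
end PhiAux
end

section
namespace PhiAux
open Polynomial Polynomial.Bivariate

section count
variable {k : Type*} [Field k]

/-- The polynomial `(1+z)^l + z^l`. -/
noncomputable def TT (k : Type*) [Field k] (l : ℕ) : k[X] := (1 + X) ^ l + X ^ l

variable [CharP k 2]

lemma TT_natDegree {l : ℕ} (hl : Odd l) : (TT k l).natDegree = l - 1 := by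
  have h2 : (2 : k) = 0 := CharTwo.two_eq_zero
  obtain ⟨m, rfl⟩ := hl
  apply natDegree_eq_of_le_of_coeff_ne_zero
  · rw [natDegree_le_iff_coeff_eq_zero]
    intro N hN
    rw [TT, coeff_add, coeff_one_add_X_pow, coeff_X_pow]
    rcases eq_or_lt_of_le (show 2 * m + 1 ≤ N by omega) with h | h
    · subst h; simp; linear_combination h2
    · rw [Nat.choose_eq_zero_of_lt h, if_neg (by omega)]; simp
  · rw [TT, coeff_add, coeff_one_add_X_pow, coeff_X_pow, if_neg (by omega)]
    have := natCast_odd (k := k) (S := k) (l := 2 * m + 1) ⟨m, rfl⟩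
    simp only [Nat.add_sub_cancel, Nat.choose_succ_self_right, this, add_zero]
    exact one_ne_zero

lemma TT_ne_zero {l : ℕ} (hl : Odd l) : TT k l ≠ 0 := by
  intro h
  have h0 := congrArg (eval 0) h
  have := hl.pos.ne'
  simp [TT, this] at h0

lemma TT_sep {l : ℕ} (hl : Odd l) : (TT k l).Separable := by
  have h2 : (2 : k[X]) = 0 := two_zero (k := k)
  have hd : derivative (TT k l) = (1 + X) ^ (l-1) + X ^ (l-1) := by
    simp [TT, derivative_pow, natCast_odd (k := k) hl]
  have hc : IsCoprime ((1 + X : k[X]) ^ (l-1)) (X ^ (l-1)) :=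
    IsCoprime.pow ⟨1, -1, by ring⟩
  obtain ⟨a, b, hab⟩ := hc
  obtain ⟨m, hm⟩ : ∃ m, l = m + 1 := ⟨l - 1, by have := hl.pos; omega⟩
  subst hm
  rw [Separable, hd]
  refine ⟨a + b, a * X + b * (1 + X), ?_⟩
  refine Eq.trans ?_ hab
  rw [TT]
  simp only [Nat.add_sub_cancel] at *
  rw [pow_succ, pow_succ]
  linear_combination (a * X * (1+X)^m + a * X * X^m + b * (1 + X) * (1+X)^m + b * X * X ^ m) * h2

/-- pointwise conditions for nodes. -/
def Nodal (l n : ℕ) (v t : k) : Prop :=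
  (1 + t) ^ l + t ^ l = 0 ∧ t ≠ 0 ∧ v ≠ 0 ∧ v ≠ 1 ∧ (v ^ n + t) ^ l = t ^ l ∧
    v ^ n + (1 + t) * v ^ (n-1) + t = 0

lemma nodal_of {l n : ℕ} (hl : Odd l) (hn : 1 ≤ n) (he : Even n) {A B : k[X][Y]}
    (hAB : A * B = HH k l n)
    {v t : k} (hA : A.evalEval v t = 0) (hB : B.evalEval v t = 0) :
    Nodal l n v t ∧ ∃ r : k[X][Y], r.evalEval v t ≠ 0 ∧ r * C (X - C v) ∈ Ideal.span {A, B} ∧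
      r * (Y - C (C t)) ∈ Ideal.span {A, B} := by
  obtain ⟨h1, h2, h3, r, h4, h5, h6⟩ := node hl hn he hAB hA hB
  have two : (2 : k) = 0 := CharTwo.two_eq_zero
  obtain ⟨m, hm⟩ : ∃ m, l = m + 1 := ⟨l - 1, by have := hl.pos; omega⟩
  obtain ⟨p, hp⟩ : ∃ p, n = p + 1 := ⟨n - 1, by omega⟩
  subst hm; subst hp
  simp only [Nat.add_sub_cancel] at *
  have ht : t ≠ 0 := by
    rintro rfl
    simp at h1
  have hs : (1 + t) ≠ 0 := by
    intro h
    rw [h] at h1; simp [ht] at h1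
  have hu : v ^ (p+1) + t ≠ 0 := by
    intro h
    rw [h] at h3; simp [ht] at h3
  have hD : (1 + t) ^ m + t ^ m ≠ 0 := by
    intro h
    have : t ^ m = 0 := by
      linear_combination h1 - (1 + t) * h + t ^ m * two
    exact pow_ne_zero _ ht this
  have hvv : r.evalEval v t * (v ^ 2 + v) ≠ 0 := by rw [h4]; exact hD
  have hr := left_ne_zero_of_mul hvv
  have hv := right_ne_zero_of_mul hvv
  have hv0 : v ≠ 0 := by rintro rfl; simp at hv
  have hv1 : v ≠ 1 := by rintro rfl; apply hv; linear_combination two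
  refine ⟨⟨h1, ht, hv0, hv1, by linear_combination h3 - t ^ (m+1) * two, ?_⟩, r, hr, h5, h6⟩
  simp only [Nat.add_sub_cancel]
  have h1' : (1 + t) * (1 + t) ^ m = t * t ^ m := by
    linear_combination h1 - t ^ (m+1) * two
  have h3' : (v ^ (p+1) + t) * (v ^ (p+1) + t) ^ m = t * t ^ m := by
    linear_combination h3 - t ^ (m+1) * two
  generalize (1 + t) ^ m = sm at *
  generalize hum : (v ^ (p+1) + t) ^ m = um at *
  have htm : t ^ m ≠ 0 := pow_ne_zero _ ht
  generalize t ^ m = tm at *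
  have key : v * tm * (v ^ (p+1) + (1 + t) * v ^ p + t) = 0 := by
    have e : (1 + t) * (v ^ (p+1) + t) * (v * (sm + tm) + um + tm) = 0 := by rw [h2, mul_zero]
    rw [pow_succ] at *
    linear_combination e - (v ^ p * v + t) * v * h1' - (1 + t) * h3' - (v * tm * t ^ 2 + v ^ 2 * v ^ p * tm * t + tm * t + tm * t ^ 2) * two
  exact (mul_eq_zero.1 key).resolve_left (mul_ne_zero hv0 htm)

lemma nodes_t [DecidableEq k] {l : ℕ} (hl : Odd l) : (TT k l).roots.toFinset.card ≤ l - 1 := by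
  rw [← TT_natDegree (k := k) hl]
  exact (Multiset.toFinset_card_le _).trans (card_roots' _)

lemma nodes_le {l n : ℕ} (hl : Odd l) (hn : 2 ≤ n) :
    ∃ N : Finset (k × k), (∀ v t : k, Nodal l n v t → (v, t) ∈ N) ∧ N.card ≤ (l - 1) * (n - 1) := by
  classical
  have two : (2 : k) = 0 := CharTwo.two_eq_zero
  let Q : k → k[X] := fun t => X ^ n + C (1 + t) * X ^ (n-1) + C t
  have hQm : ∀ t, (Q t).natDegree = n ∧ Q t ≠ 0 := by
    intro t
    have h1 : (Q t).natDegree = n := by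
      simp only [Q]; rw [add_assoc]
      rw [natDegree_add_eq_left_of_natDegree_lt]
      · simp
      · rw [natDegree_X_pow]
        refine (natDegree_add_le_of_degree_le (natDegree_C_mul_X_pow_le _ _) (by simp)).trans_lt (by omega)
    exact ⟨h1, fun h => by rw [h] at h1; simp at h1; omega⟩
  refine ⟨(TT k l).roots.toFinset.biUnion
    (fun t => ((Q t).roots.toFinset.erase 1).image (fun v => (v, t))), ?_, ?_⟩
  · rintro v t ⟨h1, h2, h3, h4, h5, h6⟩
    simp only [Finset.mem_biUnion, Multiset.mem_toFinset, Finset.mem_image, Finset.mem_erase]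
    refine ⟨t, ?_, v, ⟨h4, ?_⟩, rfl⟩
    · rw [mem_roots (TT_ne_zero hl)]; simpa [TT] using h1
    · rw [mem_roots (hQm t).2]; simpa [Q] using h6
  · refine (Finset.card_biUnion_le_card_mul _ _ (n - 1) ?_).trans
      (Nat.mul_le_mul_right _ (nodes_t hl))
    intro t _
    refine Finset.card_image_le.trans ?_
    have h1 : (1 : k) ∈ (Q t).roots.toFinset := by
      rw [Multiset.mem_toFinset, mem_roots (hQm t).2]
      simp only [Q, IsRoot.def, eval_add, eval_mul, eval_pow, eval_X, eval_C, one_pow]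
      linear_combination (1 + t) * two
    rw [Finset.card_erase_of_mem h1]
    have := (Multiset.toFinset_card_le _).trans (card_roots' (Q t))
    rw [(hQm t).1] at this
    omega

lemma nodes_le_three (i : ℕ) :
    ∃ N : Finset (k × k), (∀ v t : k, Nodal 3 (2 ^ i) v t → (v, t) ∈ N) ∧ N.card ≤ 2 := by
  classical
  have two : (2 : k) = 0 := CharTwo.two_eq_zero
  have hl : Odd 3 := by decide
  have inj : ∀ a b : k, a ^ 2 ^ i = b ^ 2 ^ i → a = b := by
    intro a b h
    have := sub_pow_char_pow (p := 2) (n := i) a b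
    rw [h, sub_self] at this
    exact sub_eq_zero.1 (pow_eq_zero_iff (by positivity) |>.1 this)
  let Q : k → k[X] := fun t => X ^ 2 ^ i - C (1 + t)
  have hQ : ∀ t, Q t ≠ 0 := fun t => X_pow_sub_C_ne_zero (by positivity) _
  refine ⟨(TT k 3).roots.toFinset.biUnion
    (fun t => ((Q t).roots.toFinset).image (fun v => (v, t))), ?_, ?_⟩
  · rintro v t ⟨h1, h2, h3, h4, h5, h6⟩
    simp only [Finset.mem_biUnion, Multiset.mem_toFinset, Finset.mem_image]
    refine ⟨t, ?_, v, ?_, rfl⟩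
    · rw [mem_roots (TT_ne_zero hl)]; simpa [TT] using h1
    · rw [mem_roots (hQ t)]
      simp only [Q, IsRoot.def, eval_sub, eval_pow, eval_X, eval_C]
      have ha : v ^ 2 ^ i ≠ 0 := pow_ne_zero _ h3
      have hb : v ^ 2 ^ i + 1 ≠ 0 := by
        intro h
        apply h4
        apply inj
        rw [one_pow]; linear_combination h - two
      have : v ^ 2 ^ i * (v ^ 2 ^ i + 1) * (v ^ 2 ^ i - (1 + t)) = 0 := by
        generalize v ^ 2 ^ i = w at *
        linear_combination h5 + (-2 * w * t - w) * two - w * h1 + (w + 3 * w * t + w * t ^ 3 - 2 * w ^ 2 * t) * two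
      exact (mul_eq_zero.1 this).resolve_left (mul_ne_zero ha hb)
  · refine (Finset.card_biUnion_le_card_mul _ _ 1 ?_).trans
      (by have := nodes_t (k := k) hl; omega)
    intro t _
    refine Finset.card_image_le.trans ?_
    rw [Finset.card_le_one]
    intro a ha b hb
    rw [Multiset.mem_toFinset, mem_roots (hQ t)] at ha hb
    simp only [Q, IsRoot.def, eval_sub, eval_pow, eval_X, eval_C] at ha hb
    apply inj
    linear_combination ha - hb

end count
end PhiAux
end

section
namespace PhiAux
open Polynomial Polynomial.Bivariate

lemma lc_dvd {D : Type*} [CommRing D] [IsDomain D] (p q A B : D[X]) (M : WithBot ℕ)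
    (hc : IsCoprime A.leadingCoeff B.leadingCoeff) (h : degree (p * A + q * B) < M)
    (h' : ¬ degree (p * A) < M) : B.leadingCoeff ∣ p.leadingCoeff := by
  have hlt : degree (p * A + q * B) < degree (p * A) := lt_of_lt_of_le h (not_lt.1 h')
  have e := leadingCoeff_sub_of_degree_lt' hlt
  rw [add_sub_cancel_left, leadingCoeff_mul, leadingCoeff_mul] at e
  have : B.leadingCoeff ∣ p.leadingCoeff * A.leadingCoeff :=
    ⟨-q.leadingCoeff, by rw [mul_neg, mul_comm B.leadingCoeff, e, neg_neg]⟩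
  exact hc.symm.dvd_of_dvd_mul_right this

/-- reduction step: Bezout expressions can be taken of small degree. -/
lemma reduce {D : Type*} [CommRing D] [IsDomain D] (A B f : D[X])
    (hc : IsCoprime A.leadingCoeff B.leadingCoeff) (hA : A ≠ 0) (hB : B ≠ 0)
    (hf : degree f < ((A.natDegree + B.natDegree : ℕ) : WithBot ℕ)) (d : ℕ) :
    ∀ P Q : D[X], P * A + Q * B = f → degree P < ((B.natDegree + d : ℕ) : WithBot ℕ) →
    ∃ P Q : D[X], P * A + Q * B = f ∧ degree P < (B.natDegree : WithBot ℕ) ∧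
      degree Q < (A.natDegree : WithBot ℕ) := by
  induction d with
  | zero =>
    intro P Q h hP
    refine ⟨P, Q, h, hP, ?_⟩
    rw [add_zero] at hP
    by_cases hQ : Q = 0
    · rw [hQ, degree_zero]; exact WithBot.bot_lt_coe _
    have h1 : degree (P * A) < ((A.natDegree + B.natDegree : ℕ) : WithBot ℕ) := by
      by_cases hP0 : P = 0
      · rw [hP0, zero_mul, degree_zero]; exact WithBot.bot_lt_coe _
      rw [← natDegree_lt_iff_degree_lt hP0] at hP
      rw [← natDegree_lt_iff_degree_lt (mul_ne_zero hP0 hA), natDegree_mul hP0 hA]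
      omega
    have h2 : degree (Q * B) < ((A.natDegree + B.natDegree : ℕ) : WithBot ℕ) := by
      have : Q * B = f - P * A := by rw [← h]; ring
      rw [this]
      exact (degree_sub_le _ _).trans_lt (max_lt hf h1)
    rw [← natDegree_lt_iff_degree_lt (mul_ne_zero hQ hB), natDegree_mul hQ hB] at h2
    rw [← natDegree_lt_iff_degree_lt hQ]
    omega
  | succ d ih =>
    intro P Q h hP
    by_cases hlt : degree P < ((B.natDegree + d : ℕ) : WithBot ℕ)
    · exact ih P Q h hlt
    have hP0 : P ≠ 0 := by
      rintro rfl
      apply hlt; rw [degree_zero]; exact WithBot.bot_lt_coe _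
    have hPd : P.natDegree = B.natDegree + d := by
      rw [← natDegree_lt_iff_degree_lt hP0] at hlt hP
      omega
    have hdvd : B.leadingCoeff ∣ P.leadingCoeff := by
      refine lc_dvd P Q A B _ hc (by rw [h]; exact hf) ?_
      rw [← natDegree_lt_iff_degree_lt (mul_ne_zero hP0 hA), natDegree_mul hP0 hA]
      omega
    obtain ⟨c, hcc⟩ := hdvd
    have hc0 : c ≠ 0 := by
      rintro rfl
      rw [mul_zero, leadingCoeff_eq_zero] at hcc
      exact hP0 hcc
    refine ih (P - C c * X ^ d * B) (Q + C c * X ^ d * A) (by rw [← h]; ring) ?_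
    have hd2 : degree (C c * X ^ d * B) = degree P := by
      rw [degree_mul, degree_C_mul_X_pow _ hc0, degree_eq_natDegree hB, degree_eq_natDegree hP0, hPd]
      push_cast; rw [add_comm]
    have : degree (P - C c * X ^ d * B) < degree P := by
      apply degree_sub_lt_left hd2.symm hP0
      rw [leadingCoeff_mul, leadingCoeff_mul, leadingCoeff_C, leadingCoeff_X_pow, hcc]; ring
    rwa [degree_eq_natDegree hP0, hPd] at this

section theta
variable {k : Type*} [Field k]

/-- weighted homogenisation `t ↦ z V^n`; in the target `z` is the inner variable. -/
noncomputable def theta (k : Type*) [Field k] (n : ℕ) : k[X][Y] →ₐ[k] k[X][Y] :=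
  aevalAeval (Y : k[X][Y]) (C X * Y ^ n)

lemma theta_C (n : ℕ) (p : k[X]) : theta k n (C p) = p.map C := by
  have hX : theta k n (C X) = X := by simp [theta]
  induction p using Polynomial.induction_on' with
  | add p q hp hq => simp only [map_add, Polynomial.map_add, hp, hq]
  | monomial j a =>
    rw [← C_mul_X_pow_eq_monomial, map_mul, map_mul, map_pow, map_pow, hX]
    have : theta k n (C (C a)) = C (C a) := (theta k n).commutes a
    rw [this]; simp

lemma theta_Y (n : ℕ) : theta k n Y = C X * Y ^ n := by
  simp [theta]

lemma theta_coeff (n : ℕ) (f : k[X][Y]) (m s : ℕ) :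
    ((theta k n f).coeff m).coeff s = if n * s ≤ m then (f.coeff s).coeff (m - n * s) else 0 := by
  induction f using Polynomial.induction_on' with
  | add p q hp hq => rw [map_add, coeff_add, coeff_add, hp, hq]; split_ifs <;> simp
  | monomial j a =>
    rw [← C_mul_X_pow_eq_monomial, map_mul, map_pow, theta_C, theta_Y, mul_pow, ← C_pow, ← pow_mul,
      ← mul_assoc, coeff_mul_X_pow', coeff_C_mul_X_pow]
    by_cases hs : s = j
    · subst hs
      rw [if_pos rfl]
      split_ifs with h
      · rw [mul_comm, coeff_C_mul, coeff_map, coeff_X_pow_mul']; simp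
      · rw [coeff_zero]
    · rw [if_neg hs]
      simp only [coeff_zero, ite_self]
      split_ifs with h
      · rw [mul_comm, coeff_C_mul, coeff_map, mul_comm, coeff_C_mul_X_pow, if_neg hs]
      · simp

lemma theta_inj {n : ℕ} {f : k[X][Y]} (h : theta k n f = 0) : f = 0 := by
  ext s e
  have := theta_coeff n f (e + n * s) s
  rw [h] at this
  simpa using this.symm

lemma theta_coeff_natDegree (n : ℕ) (f : k[X][Y]) (m : ℕ) :
    ((theta k n f).coeff m).natDegree ≤ f.natDegree := by
  rw [natDegree_le_iff_coeff_eq_zero]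
  intro s hs
  rw [theta_coeff, coeff_eq_zero_of_natDegree_lt hs]; simp

lemma weight_iff (n : ℕ) (f : k[X][Y]) (M : ℕ) :
    degree (theta k n f) < M ↔ ∀ s, degree (f.coeff s) < ((M - n * s : ℕ) : WithBot ℕ) := by
  simp only [degree_lt_iff_coeff_zero]
  constructor
  · intro h s e he
    have := theta_coeff n f (e + n * s) s
    rw [h _ (by omega)] at this
    simpa using this.symm
  · intro h m hm
    ext s
    rw [theta_coeff]
    split_ifs with hs
    · rw [h s _ (by omega)]; simp
    · simp

/-- weight reduction. -/
lemma weight_step (n : ℕ) (A B P Q : k[X][Y]) (hA0 : A ≠ 0)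
    (hc : IsCoprime (theta k n A).leadingCoeff (theta k n B).leadingCoeff)
    (hB : B.natDegree ≤ (theta k n B).leadingCoeff.natDegree)
    (hwA : n * A.natDegree ≤ (theta k n A).natDegree)
    (hP : degree P < (B.natDegree : WithBot ℕ)) (M : ℕ)
    (hf : degree (theta k n (P * A + Q * B)) < M) :
    degree (theta k n (P * A)) < M ∧
      degree (theta k n P) < ((M - n * A.natDegree : ℕ) : WithBot ℕ) := by
  by_cases hP0 : P = 0
  · subst hP0
    simp only [zero_mul, map_zero, degree_zero]
    exact ⟨WithBot.bot_lt_coe _, WithBot.bot_lt_coe _⟩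
  have hP1 : theta k n P ≠ 0 := fun h => hP0 (theta_inj h)
  have hA1 : theta k n A ≠ 0 := fun h => hA0 (theta_inj h)
  rw [← natDegree_lt_iff_degree_lt hP0] at hP
  have h1 : degree (theta k n (P * A)) < M := by
    by_contra hcon
    rw [map_mul] at hcon
    rw [map_add, map_mul, map_mul] at hf
    have := natDegree_le_of_dvd (lc_dvd _ _ _ _ _ hc hf hcon) (leadingCoeff_ne_zero.2 hP1)
    have h3 := theta_coeff_natDegree n P (theta k n P).natDegree
    rw [coeff_natDegree] at h3
    omega
  refine ⟨h1, ?_⟩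
  rw [map_mul, ← natDegree_lt_iff_degree_lt (mul_ne_zero hP1 hA1), natDegree_mul hP1 hA1] at h1
  rw [← natDegree_lt_iff_degree_lt hP1]
  omega

end theta
end PhiAux
end

section
namespace PhiAux
open Polynomial Polynomial.Bivariate

section linalg
variable {k : Type*} [Field k]

/-- parameter space for polynomials of bounded degree and weight. -/
abbrev Wt (k : Type*) [Field k] (n D M : ℕ) : Type _ := (s : Fin D) → degreeLT k (M - n * s)

lemma finrank_Wt (n D M : ℕ) :
    Module.finrank k (Wt k n D M) = ∑ s ∈ Finset.range D, (M - n * s) := by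
  rw [Module.finrank_pi_fintype, Finset.sum_range]
  refine Finset.sum_congr rfl fun s _ => ?_
  rw [(degreeLTEquiv k _).finrank_eq, Module.finrank_fin_fun]

instance (n D M : ℕ) : Module.Finite k (Wt k n D M) := by
  have : ∀ m, Module.Finite k (degreeLT k m) := fun m =>
    Module.Finite.equiv (degreeLTEquiv k m).symm
  infer_instance

/-- inclusion of the parameter space. -/
noncomputable def iota (n D M : ℕ) : Wt k n D M →ₗ[k] k[X][Y] where
  toFun f := ∑ s : Fin D, monomial (s : ℕ) (f s : k[X])
  map_add' f g := by simp [Finset.sum_add_distrib]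
  map_smul' c f := by
    rw [Finset.smul_sum]
    refine Finset.sum_congr rfl fun s _ => ?_
    rw [RingHom.id_apply, smul_monomial]
    rfl

lemma iota_coeff (n D M : ℕ) (f : Wt k n D M) (s : ℕ) :
    (iota n D M f).coeff s = if h : s < D then (f ⟨s, h⟩ : k[X]) else 0 := by
  simp only [iota, LinearMap.coe_mk, AddHom.coe_mk, finsetSum_coeff, coeff_monomial]
  split_ifs with h
  · rw [Finset.sum_eq_single ⟨s, h⟩]
    · simp
    · intro b _ hb
      rw [if_neg]
      intro h'; apply hb; ext; exact h'
    · simp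
  · apply Finset.sum_eq_zero
    intro b _
    rw [if_neg]; have := b.2; omega

lemma iota_inj (n D M : ℕ) : Function.Injective (iota (k := k) n D M) := by
  intro f g h
  ext1 s
  have := congrArg (fun p => coeff p (s : ℕ)) h
  simp only [iota_coeff, s.2, dif_pos] at this
  exact Subtype.ext this

lemma iota_weight (n D M : ℕ) (f : Wt k n D M) : degree (theta k n (iota n D M f)) < M := by
  rw [weight_iff]
  intro s
  rw [iota_coeff]
  split_ifs with h
  · exact mem_degreeLT.1 (f ⟨s, h⟩).2
  · rw [degree_zero]; exact WithBot.bot_lt_coe _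

lemma iota_degree (n D M : ℕ) (f : Wt k n D M) : degree (iota n D M f) < D := by
  rw [degree_lt_iff_coeff_zero]
  intro m hm
  rw [iota_coeff, dif_neg (by omega)]

lemma exists_iota {n D M : ℕ} {f : k[X][Y]} (h1 : degree f < D) (h2 : degree (theta k n f) < M) :
    ∃ g, iota n D M g = f := by
  rw [weight_iff] at h2
  refine ⟨fun s => ⟨f.coeff s, mem_degreeLT.2 (h2 s)⟩, ?_⟩
  ext1 s
  rw [iota_coeff]
  split_ifs with h
  · rfl
  · rw [degree_lt_iff_coeff_zero] at h1
    rw [h1 s (by omega)]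

theorem bezout_count (n : ℕ) (A B : k[X][Y]) (hA0 : A ≠ 0) (hB0 : B ≠ 0)
    (hlc : IsCoprime A.leadingCoeff B.leadingCoeff)
    (hc : IsCoprime (theta k n A).leadingCoeff (theta k n B).leadingCoeff)
    (hA : A.natDegree ≤ (theta k n A).leadingCoeff.natDegree)
    (hB : B.natDegree ≤ (theta k n B).leadingCoeff.natDegree)
    (hwA : n * A.natDegree ≤ (theta k n A).natDegree)
    (hwB : n * B.natDegree ≤ (theta k n B).natDegree)
    (N : Finset (k × k))
    (hN : ∀ f : k[X][Y], (∀ p ∈ N, f.evalEval p.1 p.2 = 0) → f ∈ Ideal.span {A, B}) :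
    n * A.natDegree * B.natDegree ≤ N.card := by
  set a := A.natDegree with ha
  set b := B.natDegree with hb
  set M := n * (a + b) with hM
  let e : Wt k n (a + b) M →ₗ[k] (N → k) :=
    LinearMap.pi (fun p => (aevalAeval (R := k) p.1.1 p.1.2).toLinearMap ∘ₗ iota n (a + b) M)
  let Ψ : (Wt k n b (M - n * a) × Wt k n a (M - n * b)) →ₗ[k] k[X][Y] :=
    (LinearMap.mulRight k A ∘ₗ iota n b (M - n * a)).coprod
      (LinearMap.mulRight k B ∘ₗ iota n a (M - n * b))
  have hker : (LinearMap.ker e).map (iota n (a + b) M) ≤ LinearMap.range Ψ := by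
    rintro _ ⟨g, hg, rfl⟩
    set f := iota n (a + b) M g with hf
    have hfz : ∀ p ∈ N, f.evalEval p.1 p.2 = 0 := by
      intro p hp
      have := congrFun (LinearMap.mem_ker.1 hg) ⟨p, hp⟩
      simpa [e, ← hf, coe_aevalAeval_eq_evalEval] using this
    obtain ⟨P0, Q0, h0⟩ := Ideal.mem_span_pair.1 (hN f hfz)
    obtain ⟨P, Q, h1, hP, hQ⟩ := reduce A B f hlc hA0 hB0 (iota_degree _ _ _ _) (P0.natDegree + 1) P0 Q0 h0
      (lt_of_le_of_lt degree_le_natDegree (by exact_mod_cast (by omega)))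
    have hw := iota_weight n (a+b) M g
    rw [← hf] at hw
    obtain ⟨hw1, hw2⟩ := weight_step n A B P Q hA0 hc hB hwA hP M (by rw [h1]; exact hw)
    obtain ⟨hw3, hw4⟩ := weight_step n B A Q P hB0 hc.symm hA hwB hQ M
      (by rw [add_comm, h1]; exact hw)
    obtain ⟨p, hp⟩ := exists_iota hP hw2
    obtain ⟨q, hq⟩ := exists_iota hQ hw4
    refine ⟨(p, q), ?_⟩
    simp only [Ψ, LinearMap.coprod_apply, LinearMap.comp_apply, LinearMap.mulRight_apply]
    rw [← h1, ← hp, ← hq]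
  have r1 := LinearMap.finrank_range_add_finrank_ker e
  have r2 : Module.finrank k (LinearMap.range e) ≤ N.card := by
    refine (Submodule.finrank_le _).trans ?_
    simp
  have r3 : Module.finrank k (LinearMap.ker e) ≤ Module.finrank k (LinearMap.range Ψ) := by
    rw [(Submodule.equivMapOfInjective _ (iota_inj n (a + b) M) (LinearMap.ker e)).finrank_eq]
    exact Submodule.finrank_mono hker
  have r4 := LinearMap.finrank_range_le Ψ
  rw [Module.finrank_prod, finrank_Wt, finrank_Wt] at r4
  rw [finrank_Wt] at r1
  have s0 : ∑ s ∈ Finset.range (a + b), (M - n * s) = ∑ s ∈ Finset.range b, (M - n * s) +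
      ∑ s ∈ Finset.range a, (M - n * (b + s)) := by
    rw [add_comm a b, Finset.sum_range_add]
  have s1 : ∑ s ∈ Finset.range b, (M - n * s) = ∑ s ∈ Finset.range b, (M - n * a - n * s) + b * (n * a) := by
    have hcst : b * (n * a) = ∑ _s ∈ Finset.range b, n * a := by simp
    rw [hcst, ← Finset.sum_add_distrib]
    refine Finset.sum_congr rfl fun s hs => ?_
    have hs := Finset.mem_range.1 hs
    have : n * s ≤ n * b := Nat.mul_le_mul_left _ hs.le
    rw [hM, mul_add]; omega
  have s2 : ∑ s ∈ Finset.range a, (M - n * (b + s)) = ∑ s ∈ Finset.range a, (M - n * b - n * s) := by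
    refine Finset.sum_congr rfl fun s hs => ?_
    rw [mul_add]; omega
  rw [s0, s1, s2] at r1
  have : n * a * b = b * (n * a) := by ring
  omega

end linalg
end PhiAux
end

section
namespace PhiAux
open Polynomial Polynomial.Bivariate

section core
variable {k : Type*} [Field k] [CharP k 2]

lemma EE_natDegree {l n : ℕ} (hl : Odd l) (hn : 2 ≤ n) :
    (EE k l n).natDegree = l - 1 ∧ (EE k l n).leadingCoeff = X + X ^ n := by
  have h2 : (2 : k[X]) = 0 := two_zero (k := k)
  have h2k : (2 : k) = 0 := CharTwo.two_eq_zero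
  have hlp := hl.pos
  have hco : ∀ s, (EE k l n).coeff s = X * ((l.choose s : k[X]) + if s = l then 1 else 0)
      + (X ^ n) ^ (l - s) * (l.choose s : k[X]) + if s = l then 1 else 0 := by
    intro s
    rw [EE, coeff_add, coeff_add, coeff_C_mul, coeff_add, coeff_one_add_X_pow, coeff_X_pow, ← C_pow,
      add_comm (C (X ^ n)), coeff_X_add_C_pow]
  have hX : (X + X ^ n : k[X]) ≠ 0 := by
    intro h
    have := congrArg (fun p => coeff p 1) h
    simp [coeff_X_pow, show (1 : ℕ) ≠ n by omega] at this
  have htop : (EE k l n).coeff (l - 1) = X + X ^ n := by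
    rw [hco, if_neg (by omega), Nat.choose_symm hlp, Nat.choose_one_right, natCast_odd (k := k) hl,
      show l - (l - 1) = 1 by omega]
    ring
  have hd : (EE k l n).natDegree = l - 1 := by
    apply natDegree_eq_of_le_of_coeff_ne_zero
    · rw [natDegree_le_iff_coeff_eq_zero]
      intro s hs
      rw [hco]
      rcases eq_or_lt_of_le (show l ≤ s by omega) with h | h
      · subst h; simp; linear_combination (X + 1) * h2
      · rw [Nat.choose_eq_zero_of_lt h, if_neg (by omega)]; simp
    · rw [htop]; exact hX
  exact ⟨hd, by rw [leadingCoeff, hd, htop]⟩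

lemma lc_sep {n : ℕ} (he : Even n) : (X + X ^ n : k[X]).Separable := by
  obtain ⟨m, rfl⟩ := he
  have h2 : (2 : k[X]) = 0 := two_zero (k := k)
  have : derivative (X + X ^ (m + m) : k[X]) = 1 := by
    rw [derivative_add, derivative_X, derivative_X_pow]
    have : (C ((m + m : ℕ) : k) : k[X]) = 0 := by
      rw [map_natCast]; push_cast; linear_combination (m : k[X]) * h2
    rw [this]; ring
  rw [Separable, this]; exact isCoprime_one_right

lemma theta_EE {l n : ℕ} (hl : Odd l) (hn : 2 ≤ n) :
    (theta k n (EE k l n)).leadingCoeff = TT k l := by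
  have hlp := hl.pos
  have e : theta k n (EE k l n) = Y * aeval (C X * Y ^ n : k[X][Y]) (TT k l) + C (TT k l) * Y ^ (n * l) := by
    have hX : theta k n (C X) = Y := by rw [theta_C, map_X]
    simp only [EE, TT, map_add, map_mul, map_pow, map_one, hX, theta_Y, aeval_X, C_add, C_pow, C_1]
    have h1 : (Y ^ n + C X * Y ^ n : k[X][Y]) ^ l = (1 + C X) ^ l * Y ^ (n * l) := by
      rw [pow_mul, ← mul_pow]; ring
    rw [h1]; ring
  have hd : (aeval (C X * Y ^ n : k[X][Y]) (TT k l)).natDegree ≤ n * (l - 1) := by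
    rw [aeval_eq_sum_range, TT_natDegree hl]
    apply natDegree_sum_le_of_forall_le
    intro i hi
    refine (natDegree_smul_le _ _).trans ?_
    rw [mul_pow, ← C_pow, ← pow_mul]
    refine (natDegree_C_mul_X_pow_le _ _).trans (Nat.mul_le_mul_left _ ?_)
    have := Finset.mem_range.1 hi
    omega
  have hT := TT_ne_zero (k := k) hl
  have hlt : degree (Y * aeval (C X * Y ^ n : k[X][Y]) (TT k l)) < degree (C (TT k l) * Y ^ (n * l)) := by
    rw [degree_C_mul_X_pow _ hT]
    refine lt_of_le_of_lt degree_le_natDegree ?_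
    have h1 := natDegree_mul_le (p := (Y : k[X][Y])) (q := aeval (C X * Y ^ n : k[X][Y]) (TT k l))
    rw [natDegree_X] at h1
    have h3 : n * (l - 1) + n = n * l := by
      obtain ⟨m, rfl⟩ : ∃ m, l = m + 1 := ⟨l - 1, by omega⟩
      simp; ring
    exact_mod_cast (show _ < n * l by omega)
  rw [e, leadingCoeff_add_of_degree_lt hlt, leadingCoeff_mul, leadingCoeff_C, leadingCoeff_X_pow, mul_one]

theorem core [IsAlgClosed k] {l n : ℕ} (hl : Odd l) (hn : 2 ≤ n) (he : Even n) {A B : k[X][Y]}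
    (hAB : A * B = HH k l n) (N : Finset (k × k))
    (hN : ∀ v t : k, Nodal l n v t → (v, t) ∈ N) :
    A.natDegree + B.natDegree = l - 1 ∧ n * A.natDegree * B.natDegree ≤ N.card := by
  have hlp := hl.pos
  have hE := HE (k := k) l n (by omega)
  rw [← hAB] at hE
  obtain ⟨hEd, hElc⟩ := EE_natDegree (k := k) hl hn
  have hX : (X + X ^ n : k[X]) ≠ 0 := (lc_sep he).ne_zero
  have hE0 : EE k l n ≠ 0 := by
    intro h; rw [h, leadingCoeff_zero] at hElc; exact hX hElc.symm
  have hABne : C (X ^ 2 + X) * (A * B) ≠ 0 := by rw [hE]; exact hE0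
  have hA0 : A ≠ 0 := left_ne_zero_of_mul (right_ne_zero_of_mul hABne)
  have hB0 : B ≠ 0 := right_ne_zero_of_mul (right_ne_zero_of_mul hABne)
  have hC0 := left_ne_zero_of_mul hABne
  have hdeg : A.natDegree + B.natDegree = l - 1 := by
    rw [← hEd, ← hE, natDegree_mul hC0 (mul_ne_zero hA0 hB0), natDegree_mul hA0 hB0, natDegree_C, zero_add]
  have hlc : IsCoprime A.leadingCoeff B.leadingCoeff := by
    have h1 : (X ^ 2 + X : k[X]) * (A.leadingCoeff * B.leadingCoeff) = X + X ^ n := by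
      rw [← hElc, ← hE, leadingCoeff_mul, leadingCoeff_mul, leadingCoeff_C]
    have h2 := lc_sep (k := k) he
    rw [← h1] at h2
    exact h2.of_mul_right.isCoprime
  have hth : (theta k n A).leadingCoeff * (theta k n B).leadingCoeff = TT k l := by
    rw [← theta_EE hl hn, ← hE, map_mul, map_mul, leadingCoeff_mul, leadingCoeff_mul, theta_C]
    have : (map C (X ^ 2 + X : k[X])).leadingCoeff = 1 := by
      apply Monic.map
      exact monic_X_pow_add (by simp)
    rw [this, one_mul]
  have hc : IsCoprime (theta k n A).leadingCoeff (theta k n B).leadingCoeff := by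
    have h2 := TT_sep (k := k) hl
    rw [← hth] at h2
    exact h2.isCoprime
  have hA1 : (theta k n A).leadingCoeff ≠ 0 := leadingCoeff_ne_zero.2 fun h => hA0 (theta_inj h)
  have hB1 : (theta k n B).leadingCoeff ≠ 0 := leadingCoeff_ne_zero.2 fun h => hB0 (theta_inj h)
  have hsum : (theta k n A).leadingCoeff.natDegree + (theta k n B).leadingCoeff.natDegree = l - 1 := by
    rw [← natDegree_mul hA1 hB1, hth, TT_natDegree hl]
  have hAle := theta_coeff_natDegree n A (theta k n A).natDegree
  have hBle := theta_coeff_natDegree n B (theta k n B).natDegree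
  rw [coeff_natDegree] at hAle hBle
  have hw : ∀ D : k[X][Y], (theta k n D).leadingCoeff ≠ 0 →
      (theta k n D).leadingCoeff.natDegree = D.natDegree → n * D.natDegree ≤ (theta k n D).natDegree := by
    intro D hD hDd
    by_contra hcon
    have := theta_coeff n D (theta k n D).natDegree D.natDegree
    rw [if_neg hcon, coeff_natDegree, ← hDd, coeff_natDegree, leadingCoeff_eq_zero] at this
    exact hD this
  refine ⟨hdeg, bezout_count n A B hA0 hB0 hlc hc (by omega) (by omega) (hw A hA1 (by omega))
    (hw B hB1 (by omega)) N ?_⟩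
  intro f hf
  have hz : ∀ v t : k, (∀ g ∈ Ideal.span {A, B}, g.evalEval v t = 0) →
      A.evalEval v t = 0 ∧ B.evalEval v t = 0 := fun v t h =>
    ⟨h A (Ideal.subset_span (by simp)), h B (Ideal.subset_span (by simp))⟩
  refine mem_of_vanish _ (fun v t h => ?_) f (fun v t h => ?_)
  · exact (nodal_of hl (by omega) he hAB (hz v t h).1 (hz v t h).2).2
  · exact hf _ (hN v t (nodal_of hl (by omega) he hAB (hz v t h).1 (hz v t h).2).1)

end core
end PhiAux
end

section
namespace PhiAux
open Polynomial Polynomial.Bivariate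

section key
variable {k : Type*} [Field k]

lemma HH_coeff {l n s : ℕ} (hs : s + 1 ≤ l) : (HH k l n).coeff s =
    (l.choose (l - s) : k[X]) * ∑ r ∈ Finset.range (n * (l - s) - 1), X ^ r := by
  rw [HH, finsetSum_coeff, Finset.sum_eq_single (l - 1 - s)]
  · rw [mul_comm, coeff_C_mul_X_pow, if_pos (by omega), show l - 1 - s + 1 = l - s by omega]
  · intro b hb hne
    have := Finset.mem_range.1 hb
    rw [mul_comm, coeff_C_mul_X_pow, if_neg (by omega)]
  · intro h
    exact absurd (Finset.mem_range.2 (by omega)) h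

variable [CharP k 2]

lemma no_content [IsAlgClosed k] {l n : ℕ} (hl : Odd l) (hl3 : 3 ≤ l) (hn : 2 ≤ n) (he : Even n)
    {A : k[X][Y]} (hA : Irreducible A) (hdvd : A ∣ HH k l n) : 1 ≤ A.natDegree := by
  by_contra hcon
  obtain ⟨a, rfl⟩ : ∃ a, A = C a := ⟨_, eq_C_of_natDegree_eq_zero (by omega)⟩
  have ha : a.degree ≠ 0 := by
    intro h
    have h1 : IsUnit a := isUnit_iff_degree_eq_zero.2 h
    exact hA.not_isUnit (h1.map C)
  obtain ⟨v, hv⟩ := IsAlgClosed.exists_root a ha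
  rw [C_dvd_iff_dvd_coeff] at hdvd
  have hz : ∀ s, ((HH k l n).coeff s).eval v = 0 := fun s => by
    obtain ⟨c, hc⟩ := hdvd s
    rw [hc, eval_mul, hv.eq_zero, zero_mul]
  have g0 := hz 0
  have g1 := hz 1
  rw [HH_coeff (by omega)] at g0 g1
  rw [Nat.choose_symm (by omega), Nat.choose_one_right, natCast_odd (k := k) hl] at g1
  simp only [Nat.sub_zero, Nat.choose_self, Nat.cast_one, one_mul, eval_finsetSum, eval_pow, eval_X] at g0 g1
  have e0 := mul_geom_sum v (n * l - 1)
  have e1 := mul_geom_sum v (n * (l - 1) - 1)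
  rw [g0] at e0
  rw [g1] at e1
  have hnl : n * l = n * (l - 1) + n := by
    obtain ⟨m, rfl⟩ : ∃ m, l = m + 1 := ⟨l - 1, by omega⟩
    simp; ring
  have hnl2 : 2 * 2 ≤ n * (l - 1) := Nat.mul_le_mul hn (by omega)
  have hvn : v ^ n = 1 := by
    have : v ^ (n * l - 1) = v ^ (n * (l - 1) - 1) * v ^ n := by
      rw [← pow_add]; congr 1; omega
    linear_combination (-1 : k) * e0 - this + v ^ n * e1
  have hv1 : v = 1 := by
    have : v ^ (n * l) = v ^ (n * l - 1) * v := by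
      rw [← pow_succ]; congr 1; omega
    rw [pow_mul, hvn, one_pow] at this
    linear_combination v * e0 - this
  subst hv1
  have hodd : Odd (n * l - 1) := by
    obtain ⟨m, rfl⟩ := he
    refine ⟨m * l - 1, ?_⟩
    have : (m + m) * l = 2 * (m * l) := by ring
    omega
  simp only [one_pow, Finset.sum_const, Finset.card_range, nsmul_eq_mul, mul_one,
    natCast_odd (k := k) hodd] at g0
  exact one_ne_zero g0

lemma EE_eval_ne {l n : ℕ} (hl : Odd l) (hn : 2 ≤ n) (t : k) : (EE k l n).eval (C t) ≠ 0 := by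
  intro h
  have hlp := hl.pos
  have e : (EE k l n).eval (C t) =
      (X ^ n + C t) ^ l + (C ((1 + t) ^ l + t ^ l) * X + C (t ^ l)) := by
    simp [EE]; ring
  rw [e] at h
  have hm : ((X ^ n + C t : k[X]) ^ l).Monic := (monic_X_pow_add_C t (by omega)).pow l
  have hd : ((X ^ n + C t : k[X]) ^ l).natDegree = l * n := by
    rw [natDegree_pow, natDegree_X_pow_add_C]
  have h1 : 1 * 2 ≤ l * n := Nat.mul_le_mul hlp hn
  have := hm.add_of_left (q := C ((1 + t) ^ l + t ^ l) * X + C (t ^ l)) (by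
    rw [degree_eq_natDegree hm.ne_zero, hd]
    refine degree_linear_le.trans_lt ?_
    exact_mod_cast (by omega))
  exact this.ne_zero h

lemma no_double [IsAlgClosed k] {l n : ℕ} (hl : Odd l) (hn : 2 ≤ n)
    {A : k[X][Y]} (hA : Irreducible A) (hdvd : A ∣ HH k l n)
    (hdvd1 : A ∣ (1 + Y : k[X][Y]) ^ l + Y ^ l) : False := by
  have h1 : A ∣ (TT k l).map C := by
    have : (TT k l).map C = (1 + Y : k[X][Y]) ^ l + Y ^ l := by simp [TT]
    rwa [this]
  have hs := (IsAlgClosed.splits (TT k l)).eq_prod_roots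
  rw [hs, Polynomial.map_mul, Polynomial.map_multiset_prod, Multiset.map_map, map_C] at h1
  rcases hA.prime.dvd_or_dvd h1 with h | h
  · have hu : IsUnit (C (C (TT k l).leadingCoeff) : k[X][Y]) :=
      ((isUnit_iff_ne_zero.2 (leadingCoeff_ne_zero.2 (TT_ne_zero hl))).map C).map C
    exact hA.not_isUnit (isUnit_of_dvd_unit h hu)
  · obtain ⟨t, _, ht⟩ := hA.prime.exists_mem_multiset_map_dvd h
    simp only [Function.comp, Polynomial.map_sub, map_X, map_C] at ht
    have h2 : (Y - C (C t)) ∣ HH k l n :=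
      ((hA.associated_of_dvd (irreducible_X_sub_C _) ht).dvd_iff_dvd_left).1 hdvd
    have h3 : (Y - C (C t)) ∣ EE k l n := by
      rw [← HE l n (by omega)]; exact h2.mul_left _
    exact EE_eval_ne hl hn t (dvd_iff_isRoot.1 h3)

/-- coefficientwise action of an automorphism. -/
noncomputable def sg (σ : k ≃+* k) : k[X][Y] ≃+* k[X][Y] := mapEquiv (mapEquiv σ)

lemma sg_C (σ : k ≃+* k) (p : k[X]) : sg σ (C p) = C (p.map (σ : k →+* k)) := by
  simp [sg]

lemma sg_Y (σ : k ≃+* k) : sg σ Y = Y := by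
  simp [sg]

lemma sg_HH (σ : k ≃+* k) (l n : ℕ) : sg σ (HH k l n) = HH k l n := by
  simp [HH, sg_C, sg_Y, map_sum, map_mul, Polynomial.map_sum, Polynomial.map_mul]

lemma sg_natDegree (σ : k ≃+* k) (A : k[X][Y]) : (sg σ A).natDegree = A.natDegree := by
  exact natDegree_map_eq_of_injective (mapEquiv σ).injective A

lemma no22 [IsAlgClosed k] {l n : ℕ} (hl : Odd l) (hn : 2 ≤ n) (he : Even n) {A B : k[X][Y]}
    (hAB : A * B = HH k l n) (hA : 2 ≤ A.natDegree) (hB : 2 ≤ B.natDegree) : False := by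
  obtain ⟨N, hN, hNc⟩ := nodes_le (k := k) hl hn
  obtain ⟨h1, h2⟩ := core hl hn he hAB N hN
  obtain ⟨a, ha⟩ : ∃ a, A.natDegree = a + 2 := ⟨A.natDegree - 2, by omega⟩
  obtain ⟨b, hb⟩ : ∃ b, B.natDegree = b + 2 := ⟨B.natDegree - 2, by omega⟩
  obtain ⟨m, rfl⟩ : ∃ m, n = m + 1 := ⟨n - 1, by omega⟩
  rw [← h1] at hNc
  rw [ha, hb] at h2 hNc
  have := h2.trans hNc
  simp only [Nat.add_sub_cancel] at this
  nlinarith [Nat.zero_le (m * a), Nat.zero_le (m * b), Nat.zero_le (m * a * b), Nat.zero_le (a * b)]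

theorem key [IsAlgClosed k] {l i : ℕ} (hl : Odd l) (hl3 : 3 ≤ l) (hi : 1 ≤ i) (hne : ¬ (i = 1 ∧ l = 3))
    (σ : k ≃+* k) :
    ∃ A : k[X][Y], Irreducible A ∧ A ∣ HH k l (2 ^ i) ∧ Associated (sg σ A) A := by
  by_contra hcon
  push Not at hcon
  have hn : 2 ≤ 2 ^ i := by
    calc 2 = 2 ^ 1 := rfl
      _ ≤ 2 ^ i := Nat.pow_le_pow_right (by norm_num) hi
  have he : Even (2 ^ i) := (Nat.even_pow.2 ⟨even_two, by omega⟩)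
  have hn3 : l = 3 → 3 ≤ 2 ^ i := by
    intro h
    have : 2 ≤ i := by
      by_contra h'
      exact hne ⟨by omega, h⟩
    calc 3 ≤ 2 ^ 2 := by norm_num
      _ ≤ 2 ^ i := Nat.pow_le_pow_right (by norm_num) this
  have hsum : ∀ A B : k[X][Y], A * B = HH k l (2 ^ i) → A.natDegree + B.natDegree = l - 1 := by
    intro A B hAB
    obtain ⟨N, hN, hNc⟩ := nodes_le (k := k) hl hn
    exact (core hl hn he hAB N hN).1
  have hH := hsum 1 (HH k l (2 ^ i)) (one_mul _)
  rw [natDegree_one, zero_add] at hH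
  have hH0 : HH k l (2 ^ i) ≠ 0 := by
    intro h; rw [h, natDegree_zero] at hH; omega
  have claim : ∀ A B : k[X][Y], Irreducible A → A * B = HH k l (2 ^ i) → A.natDegree ≤ B.natDegree := by
    intro A B hA hAB
    have hs : Irreducible (sg σ A) := (MulEquiv.irreducible_iff (sg σ)).2 hA
    have h1 : sg σ A ∣ A * B := by
      rw [hAB, ← sg_HH σ, ← hAB, map_mul]; exact dvd_mul_right _ _
    have hB0 : B ≠ 0 := by rintro rfl; rw [mul_zero] at hAB; exact hH0 hAB.symm
    rcases hs.prime.dvd_or_dvd h1 with h | h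
    · exact absurd (hs.associated_of_dvd hA h) (hcon A hA ⟨B, hAB.symm⟩)
    · rw [← sg_natDegree σ A]
      exact natDegree_le_of_dvd h hB0
  obtain ⟨A, hA, B, hAB⟩ := WfDvdMonoid.exists_irreducible_factor
    (a := HH k l (2 ^ i)) (fun h => by rw [natDegree_eq_zero_of_isUnit h] at hH; omega) hH0
  have hA1 := no_content hl hl3 hn he hA ⟨B, hAB⟩
  have hAB1 := claim A B hA hAB.symm
  have hs1 := hsum A B hAB.symm
  by_cases hA2 : 2 ≤ A.natDegree
  · exact no22 hl hn he hAB.symm hA2 (by omega)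
  have hAe : A.natDegree = 1 := by omega
  by_cases hl5 : l = 3
  · subst hl5
    have hBe : B.natDegree = 1 := by omega
    obtain ⟨N, hN, hNc⟩ := nodes_le_three (k := k) i
    have := (core hl hn he hAB.symm N hN).2
    rw [hAe, hBe] at this
    have := hn3 rfl
    omega
  have hl5 : 5 ≤ l := by
    obtain ⟨m, rfl⟩ := hl; omega
  have hB0 : B ≠ 0 := by rintro rfl; rw [mul_zero] at hAB; exact hH0 hAB
  obtain ⟨A2, hA2i, D, hD⟩ := WfDvdMonoid.exists_irreducible_factor
    (a := B) (fun h => by rw [natDegree_eq_zero_of_isUnit h] at hs1; omega) hB0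
  have e2 : A2 * (A * D) = HH k l (2 ^ i) := by rw [hAB, hD]; ring
  have e3 : (A * A2) * D = HH k l (2 ^ i) := by rw [hAB, hD]; ring
  have hA21 := no_content hl hl3 hn he hA2i ⟨_, e2.symm⟩
  by_cases hA22 : 2 ≤ A2.natDegree
  · exact no22 hl hn he e2 hA22 (hA22.trans (claim _ _ hA2i e2))
  · have hs3 := hsum _ _ e3
    have : (A * A2).natDegree = 2 := by
      rw [natDegree_mul hA.ne_zero hA2i.ne_zero]; omega
    exact no22 hl hn he e3 this.ge (by omega)

end key
end PhiAux
end

section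
namespace PhiAux
open Polynomial Polynomial.Bivariate

lemma exists_irred_dvd {R S : Type*} [CommRing R] [IsDomain R] [UniqueFactorizationMonoid R]
    [CommRing S] [IsDomain S] (φ : R →* S) {A : S} (hA : Prime A) (x : R) (hx : x ≠ 0) (h : A ∣ φ x) :
    ∃ p, Irreducible p ∧ p ∣ x ∧ A ∣ φ p := by
  revert hx h
  refine WfDvdMonoid.induction_on_irreducible x (fun h => absurd rfl h) ?_ ?_
  · intro u hu _ h
    exact absurd (isUnit_of_dvd_unit h (hu.map φ)) hA.not_isUnit
  · intro a i ha hi ih _ h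
    rw [map_mul] at h
    rcases hA.dvd_or_dvd h with h | h
    · exact ⟨i, hi, dvd_mul_right _ _, h⟩
    · obtain ⟨p, hp, hpa, hA⟩ := ih ha h
      exact ⟨p, hp, hpa.mul_left _, hA⟩

section transfer
variable {k : Type*} [Field k]

/-- the substitution `x = S(1+Z)`, `y = S(Z+V)`, `z = SZ`. -/
noncomputable def Lam (k : Type*) [Field k] : MvPolynomial (Fin 3) k →ₐ[k] (k[X][Y])[X] :=
  MvPolynomial.aeval (![X * C (1 + Y), X * C (Y + C X), X * C Y] : Fin 3 → (k[X][Y])[X])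

/-- `V ↦ V^n`. -/
noncomputable def eta (k : Type*) [Field k] (n : ℕ) : k[X][Y] →+* k[X][Y] :=
  mapRingHom (expand k n : k[X] →+* k[X])

/-- `Z ↦ Z^n`. -/
noncomputable def xi (k : Type*) [Field k] (n : ℕ) : k[X][Y] →+* k[X][Y] :=
  (expand k[X] n : k[X][Y] →+* k[X][Y])

lemma eta_Y (n : ℕ) : eta k n Y = Y := by simp [eta]
lemma eta_CX (n : ℕ) : eta k n (C X) = C X ^ n := by simp [eta]
lemma xi_Y (n : ℕ) : xi k n Y = Y ^ n := by simp [xi]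
lemma xi_C (n : ℕ) (p : k[X]) : xi k n (C p) = C p := by simp [xi]

lemma map_HH {S : Type*} [CommRing S] (φ ψ : k[X][Y] →+* S) (h1 : φ Y = ψ Y)
    (h2 : φ (C X) = ψ (C X)) (l n : ℕ) : φ (HH k l n) = ψ (HH k l n) := by
  simp only [HH, map_sum, map_mul, map_pow, map_natCast, h1, h2]

variable [CharP k 2]

lemma eta_xi_HH (l m i : ℕ) : eta k (2 ^ i) (xi k (2 ^ i) (HH k l m)) = HH k l m ^ 2 ^ i := by
  have := map_HH ((eta k (2 ^ i)).comp (xi k (2 ^ i))) (iterateFrobenius k[X][Y] 2 i)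
    (by simp [xi_Y, eta_Y, iterateFrobenius_def]) (by simp [xi_C, eta_CX, iterateFrobenius_def]) l m
  simpa [iterateFrobenius_def] using this

lemma sg_eta (σ : k ≃+* k) (n : ℕ) (f : k[X][Y]) : sg σ (eta k n f) = eta k n (sg σ f) := by
  have : ((sg σ : k[X][Y] ≃+* k[X][Y]) : k[X][Y] →+* k[X][Y]).comp (eta k n) =
      (eta k n).comp (sg σ : k[X][Y] →+* k[X][Y]) := by
    apply Polynomial.ringHom_ext'
    · apply Polynomial.ringHom_ext'
      · ext a; simp [eta, sg_C]
      · simp [eta, sg_C]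
    · simp [eta_Y, sg_Y]
  exact congrArg (fun φ => φ f) this

lemma xi_EE (l n : ℕ) : xi k n (EE k l n) =
    C X * ((1 + Y ^ n) ^ l + (Y ^ n) ^ l) + (C X ^ n + Y ^ n) ^ l + (Y ^ n) ^ l := by
  simp only [EE, map_add, map_mul, map_pow, map_one, xi_Y, xi_C]

lemma dV_xi {l n : ℕ} (hn : 1 ≤ n) (he : Even n) :
    C (X ^ 2 + X) * dV (xi k n (HH k l n)) + xi k n (HH k l n) = (1 + Y ^ n) ^ l + (Y ^ n) ^ l := by
  have h2 : (2 : k[X]) = 0 := two_zero (k := k)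
  have hYn : dV (Y ^ n : k[X][Y]) = 0 := dV_pow_eq_zero dV_Y n
  have hY : ∀ m, dV ((Y ^ n) ^ m : k[X][Y]) = 0 := fun m => dV_pow_eq_zero hYn m
  have h1 : dV ((1 + Y ^ n) ^ l : k[X][Y]) = 0 :=
    dV_pow_eq_zero (by rw [dV_add, dV_one, hYn, add_zero]) l
  have h3 : dV ((C X ^ n + Y ^ n) ^ l : k[X][Y]) = 0 :=
    dV_pow_eq_zero (by rw [dV_add, dV_pow_even _ he, hYn, add_zero]) l
  have e := congrArg dV (congrArg (xi k n) (HE (k := k) l n hn))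
  rw [xi_EE, map_mul, xi_C, dV_mul, dV_C] at e
  have : derivative (X ^ 2 + X : k[X]) = 1 := by
    rw [derivative_add, derivative_pow, derivative_X]; push_cast
    simp only [C_ofNat, h2]; ring
  rw [this] at e
  simp only [dV_add, dV_mul, hY, h1, h3, dV_C, derivative_X] at e
  rw [C_1] at e
  linear_combination e

/-- no irreducible factor of `H` divides both factors. -/
lemma no_both [IsAlgClosed k] {l i : ℕ} (hl : Odd l) (hi : 1 ≤ i) {A : k[X][Y]} (hA : Irreducible A)
    (hdvd : A ∣ HH k l (2 ^ i)) {c : k} (hc : c ≠ 0) {f g : k[X][Y]}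
    (hfg : f * g = C (C c) * xi k (2 ^ i) (HH k l (2 ^ i)))
    (hf : A ∣ eta k (2 ^ i) f) (hg : A ∣ eta k (2 ^ i) g) : False := by
  have hn : 2 ≤ 2 ^ i := by
    calc 2 = 2 ^ 1 := rfl
      _ ≤ 2 ^ i := Nat.pow_le_pow_right (by norm_num) hi
  have he : Even (2 ^ i) := (Nat.even_pow.2 ⟨even_two, by omega⟩)
  refine no_double hl hn hA hdvd ?_
  have h1 : A ∣ eta k (2 ^ i) (dV (f * g)) := by
    rw [dV_mul, map_add, map_mul, map_mul]
    exact dvd_add (hg.mul_left _) (hf.mul_right _)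
  have hcu : eta k (2 ^ i) (C (C c)) = C (C c) := by simp [eta]
  rw [hfg, dV_mul, dV_C, derivative_C, C_0, zero_mul, zero_add, map_mul, hcu] at h1
  have hu : IsUnit (C (C c) : k[X][Y]) := ((isUnit_iff_ne_zero.2 hc).map C).map C
  rw [hu.dvd_mul_left] at h1
  have e := congrArg (eta k (2 ^ i)) (dV_xi (k := k) (l := l) (n := 2 ^ i) (by omega) he)
  rw [map_add, map_mul, eta_xi_HH] at e
  have e2 : eta k (2 ^ i) ((1 + Y ^ 2 ^ i) ^ l + (Y ^ 2 ^ i) ^ l) = ((1 + Y) ^ l + Y ^ l) ^ 2 ^ i := by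
    simp only [map_add, map_pow, map_one, eta_Y]
    have a1 : ((1 + Y : k[X][Y]) ^ l) ^ 2 ^ i = (1 + Y ^ 2 ^ i) ^ l := by
      rw [pow_right_comm, add_pow_char_pow, one_pow]
    rw [add_pow_char_pow, a1, pow_right_comm (Y : k[X][Y]) l]
  rw [e2] at e
  apply hA.prime.dvd_of_dvd_pow (n := 2 ^ i)
  rw [← e]
  exact dvd_add (h1.mul_left _) (dvd_pow hdvd (by positivity))

lemma Lam_X0 : Lam k (MvPolynomial.X 0) = X * C (1 + Y) := by simp [Lam]
lemma Lam_X1 : Lam k (MvPolynomial.X 1) = X * C (Y + C X) := by simp [Lam]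
lemma Lam_X2 : Lam k (MvPolynomial.X 2) = X * C Y := by simp [Lam]

lemma two_zero3 : (2 : (k[X][Y])[X]) = 0 := by
  have h2 : (2 : k[X][Y]) = 0 := two_zero (k := k)
  rw [← map_ofNat (C : k[X][Y] →+* (k[X][Y])[X]) 2, h2, map_zero]

lemma aux_denom {S : Type*} [CommRing S] (h2 : (2 : S) = 0) (x z v : S) :
    (x * (1 + z) + x * (z + v)) * (x * (1 + z) + x * z) * (x * (z + v) + x * z) =
      (v ^ 2 + v) * x ^ 3 := by
  linear_combination (x ^ 3 * (z+3*z*v+4*z^2+z*v^2+4*z^2*v+4*z^3)) * h2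

lemma aux_numer {S : Type*} [CommRing S] (h2 : (2 : S) = 0) (x y v a b c d w : S) :
    x * (1 + y) * (d * (w * a) + d * (w * c)) + x * (y + v) * (d * (w * b) + d * (w * c)) +
      x * y * (d * (w * b) + d * (w * a)) = d * (v * (b + c) + a + c) * (w * x) := by
  linear_combination (x * w * d * y * (a + b + c)) * h2

lemma Lam_denom : Lam k (denom k) = C (C (X ^ 2 + X)) * X ^ 3 := by
  have h2 := two_zero3 (k := k)
  simp only [denom, map_mul, map_add, Lam_X0, Lam_X1, Lam_X2, map_pow, map_one]
  generalize (C Y : (k[X][Y])[X]) = z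
  generalize (C (C X) : (k[X][Y])[X]) = v
  exact aux_denom (S := (k[X][Y])[X]) h2 _ _ _

/-- the homogeneous pieces of the numerator. -/
noncomputable def Ej (k : Type*) [Field k] (j : ℕ) : k[X][Y] :=
  C X * ((1 + Y) ^ j + Y ^ j) + (C X + Y) ^ j + Y ^ j

lemma aux_numer2 {R : Type*} [CommRing R] (h2 : (2 : R) = 0) (y v d : R) (j : ℕ) :
    (X * C (1 + y) : R[X]) * (C d * (X * C (y + v)) ^ j + C d * (X * C y) ^ j) +
      X * C (y + v) * (C d * (X * C (1 + y)) ^ j + C d * (X * C y) ^ j) +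
      X * C y * (C d * (X * C (1 + y)) ^ j + C d * (X * C (y + v)) ^ j) =
      C (d * (v * ((1 + y) ^ j + y ^ j) + (v + y) ^ j + y ^ j)) * X ^ (j + 1) := by
  have h2' : (2 : R[X]) = 0 := by
    rw [← map_ofNat (C : R →+* R[X]) 2, h2, map_zero]
  simp only [mul_pow, C_add, C_mul, C_pow, C_1, pow_succ]
  rw [add_comm (C v) (C y)]
  exact aux_numer h2' _ _ _ _ _ _ _ _

lemma aux_numer3 {R : Type*} [CommRing R] (h2 : (2 : R) = 0) (y v : R) (ι : k →+* R)
    (L : MvPolynomial (Fin 3) k →+* R[X]) (hC : ∀ a, L (MvPolynomial.C a) = C (ι a))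
    (h0 : L (MvPolynomial.X 0) = X * C (1 + y)) (h1 : L (MvPolynomial.X 1) = X * C (y + v))
    (hX2 : L (MvPolynomial.X 2) = X * C y) (f : k[X]) :
    L (numer k f) = ∑ j ∈ Finset.range (f.natDegree + 1),
      C (ι (f.coeff j) * (v * ((1 + y) ^ j + y ^ j) + (v + y) ^ j + y ^ j)) * X ^ (j + 1) := by
  have hae : ∀ s : Fin 3, L (aeval (MvPolynomial.X s : MvPolynomial (Fin 3) k) f) =
      ∑ j ∈ Finset.range (f.natDegree + 1), C (ι (f.coeff j)) * L (MvPolynomial.X s) ^ j := by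
    intro s
    rw [aeval_eq_sum_range, map_sum]
    refine Finset.sum_congr rfl fun j _ => ?_
    rw [Algebra.smul_def, map_mul, map_pow, MvPolynomial.algebraMap_eq, hC]
  simp only [numer, map_add, map_mul, hae]
  simp only [← Finset.sum_add_distrib, Finset.mul_sum]
  refine Finset.sum_congr rfl fun j _ => ?_
  rw [h0, h1, hX2]
  have := aux_numer2 h2 y v (ι (f.coeff j)) j
  simpa only [map_add, map_mul] using this

lemma Lam_numer (f : k[X]) :
    Lam k (numer k f) = ∑ j ∈ Finset.range (f.natDegree + 1), C (C (C (f.coeff j)) * Ej k j) * X ^ (j + 1) :=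
  aux_numer3 (R := k[X][Y]) (two_zero (k := k)) Y (C X) (C.comp C)
    (Lam k : MvPolynomial (Fin 3) k →+* (k[X][Y])[X]) (fun a => (Lam k).commutes a)
    Lam_X0 Lam_X1 Lam_X2 f

lemma Ej_eq (l i : ℕ) : Ej k (2 ^ i * l) = xi k (2 ^ i) (EE k l (2 ^ i)) := by
  rw [xi_EE, Ej, pow_mul, pow_mul, pow_mul, add_pow_char_pow, add_pow_char_pow, one_pow]

lemma Lam_lc {l i : ℕ} (hl : Odd l) (hi : 1 ≤ i) {f : k[X]} (hf : f.natDegree = 2 ^ i * l)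
    {Φ : MvPolynomial (Fin 3) k} (hΦ : denom k * Φ = numer k f) :
    (Lam k Φ).leadingCoeff = C (C f.leadingCoeff) * xi k (2 ^ i) (HH k l (2 ^ i)) ∧
      xi k (2 ^ i) (HH k l (2 ^ i)) ≠ 0 := by
  have hn : 2 ≤ 2 ^ i := by
    calc 2 = 2 ^ 1 := rfl
      _ ≤ 2 ^ i := Nat.pow_le_pow_right (by norm_num) hi
  have hlp := hl.pos
  have hfl : f.leadingCoeff ≠ 0 := by
    rw [Ne, leadingCoeff_eq_zero]; rintro rfl
    rw [natDegree_zero] at hf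
    have : 1 * 1 ≤ 2 ^ i * l := Nat.mul_le_mul (by omega) hlp
    omega
  have hE : C (X ^ 2 + X) * xi k (2 ^ i) (HH k l (2 ^ i)) = Ej k (2 ^ i * l) := by
    rw [Ej_eq, ← HE l _ (by omega), map_mul, xi_C]
  have hE0 : Ej k (2 ^ i * l) ≠ 0 := by
    rw [Ej_eq]
    intro h
    have : EE k l (2 ^ i) = 0 := by
      apply expand_injective (R := k[X]) (n := 2 ^ i) (by positivity)
      simpa [xi] using h
    apply EE_eval_ne (k := k) hl hn 0
    rw [this, eval_zero]
  have hxi0 : xi k (2 ^ i) (HH k l (2 ^ i)) ≠ 0 := by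
    intro h; rw [h, mul_zero] at hE; exact hE0 hE.symm
  refine ⟨?_, hxi0⟩
  have hnum : (Lam k (numer k f)).leadingCoeff = C (C f.leadingCoeff) * Ej k (2 ^ i * l) := by
    have hne : C (C f.leadingCoeff) * Ej k (2 ^ i * l) ≠ 0 :=
      mul_ne_zero (by simpa using hfl) hE0
    rw [Lam_numer, Finset.sum_range_succ, coeff_natDegree, hf, leadingCoeff_add_of_degree_lt,
      leadingCoeff_mul, leadingCoeff_C, leadingCoeff_X_pow, mul_one]
    rw [degree_C_mul_X_pow _ hne]
    refine (degree_sum_le _ _).trans_lt ?_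
    rw [Finset.sup_lt_iff (WithBot.bot_lt_coe _)]
    intro j hj
    refine (degree_C_mul_X_pow_le _ _).trans_lt ?_
    have := Finset.mem_range.1 hj
    exact_mod_cast (by omega)
  rw [← hΦ, map_mul, leadingCoeff_mul, Lam_denom, leadingCoeff_mul, leadingCoeff_C, leadingCoeff_X_pow,
    mul_one, ← hE] at hnum
  have hC : (C (X ^ 2 + X) : k[X][Y]) ≠ 0 := by
    intro h; rw [h, zero_mul] at hE; exact hE0 hE.symm
  apply mul_left_cancel₀ hC
  rw [hnum]; ring

lemma Lam_map (σ : k ≃+* k) (P : MvPolynomial (Fin 3) k) :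
    Lam k (MvPolynomial.mapEquiv (Fin 3) σ P) = (Lam k P).map (sg σ : k[X][Y] →+* k[X][Y]) := by
  have : ((Lam k : MvPolynomial (Fin 3) k →+* (k[X][Y])[X])).comp
      (MvPolynomial.mapEquiv (Fin 3) σ : MvPolynomial (Fin 3) k →+* MvPolynomial (Fin 3) k) =
      (mapRingHom (sg σ : k[X][Y] →+* k[X][Y])).comp (Lam k : MvPolynomial (Fin 3) k →+* (k[X][Y])[X]) := by
    apply MvPolynomial.ringHom_ext
    · intro a
      have h1 : ∀ a : k, Lam k (MvPolynomial.C a) = C (C (C a)) := fun a => (Lam k).commutes a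
      simp [h1, sg_C]
    · intro s
      fin_cases s <;> simp [Lam_X0, Lam_X1, Lam_X2, sg_C, sg_Y]
  exact congrArg (fun φ => φ P) this

/-- leading form, as a monoid morphism. -/
noncomputable def lam (k : Type*) [Field k] (n : ℕ) : MvPolynomial (Fin 3) k →* k[X][Y] :=
  (eta k n : k[X][Y] →* k[X][Y]).comp
    (leadingCoeffHom.comp (Lam k : MvPolynomial (Fin 3) k →* (k[X][Y])[X]))

lemma lam_apply (n : ℕ) (P : MvPolynomial (Fin 3) k) : lam k n P = eta k n (Lam k P).leadingCoeff := rfl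

lemma lam_map (σ : k ≃+* k) (n : ℕ) (P : MvPolynomial (Fin 3) k) :
    lam k n (MvPolynomial.mapEquiv (Fin 3) σ P) = sg σ (lam k n P) := by
  have hinj : Function.Injective (sg σ : k[X][Y] →+* k[X][Y]) := (sg σ).injective
  rw [lam_apply, Lam_map, leadingCoeff_map_of_injective hinj, lam_apply, sg_eta]
  rfl

theorem transfer [IsAlgClosed k] {l i : ℕ} (hl : Odd l) (hl3 : 3 ≤ l) (hi : 1 ≤ i)
    (hne : ¬ (i = 1 ∧ l = 3)) {f : k[X]} (hf : f.natDegree = 2 ^ i * l)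
    {Φ : MvPolynomial (Fin 3) k} (hΦ : denom k * Φ = numer k f) (σ : k ≃+* k)
    (hσ : MvPolynomial.mapEquiv (Fin 3) σ Φ = Φ) :
    ∃ P : MvPolynomial (Fin 3) k, Irreducible P ∧ P ∣ Φ ∧
      Associated (MvPolynomial.mapEquiv (Fin 3) σ P) P := by
  obtain ⟨A, hA, hAH, hAσ⟩ := key (k := k) hl hl3 hi hne σ
  obtain ⟨hlc, hxi⟩ := Lam_lc hl hi hf hΦ
  have hfl : f.leadingCoeff ≠ 0 := by
    rw [Ne, leadingCoeff_eq_zero]; rintro rfl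
    rw [natDegree_zero] at hf
    have : 1 * 1 ≤ 2 ^ i * l := Nat.mul_le_mul Nat.one_le_two_pow hl.pos
    omega
  have hΦ0 : Φ ≠ 0 := by
    rintro rfl
    rw [map_zero, leadingCoeff_zero] at hlc
    exact mul_ne_zero (by simpa using hfl) hxi hlc.symm
  have hAΦ : A ∣ lam k (2 ^ i) Φ := by
    rw [lam_apply, hlc, map_mul, eta_xi_HH]
    exact (dvd_pow hAH (by positivity)).mul_left _
  obtain ⟨P, hP, hPΦ, hAP⟩ := exists_irred_dvd (lam k (2 ^ i)) hA.prime Φ hΦ0 hAΦ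
  refine ⟨P, hP, hPΦ, ?_⟩
  by_contra hcon
  have hsP : Irreducible (MvPolynomial.mapEquiv (Fin 3) σ P) := (MulEquiv.irreducible_iff _).2 hP
  obtain ⟨Q, hQ⟩ := hPΦ
  have h1 : MvPolynomial.mapEquiv (Fin 3) σ P ∣ P * Q := by
    rw [← hQ, ← hσ, hQ, map_mul]; exact dvd_mul_right _ _
  rcases hsP.prime.dvd_or_dvd h1 with h | h
  · exact hcon (hsP.associated_of_dvd hP h)
  obtain ⟨Q1, rfl⟩ := h
  have hA2 : A ∣ lam k (2 ^ i) (MvPolynomial.mapEquiv (Fin 3) σ P * Q1) := by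
    rw [map_mul, lam_map]
    refine Dvd.dvd.mul_right ?_ _
    rw [← hAσ.dvd_iff_dvd_left]
    obtain ⟨c, hc⟩ := hAP
    exact ⟨sg σ c, by rw [hc, map_mul]⟩
  refine no_both hl hi hA hAH hfl (f := (Lam k P).leadingCoeff)
    (g := (Lam k (MvPolynomial.mapEquiv (Fin 3) σ P * Q1)).leadingCoeff) ?_ hAP hA2
  rw [← hlc, hQ, map_mul (Lam k) P, leadingCoeff_mul]

end transfer
end PhiAux
end

namespace PhiAux
section descent
open MvPolynomial

variable {F : Type*} [Field F] [Fintype F] {K : Type*} [Field K] [Algebra F K]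

lemma mem_range_of_pow (a : K) (ha : a ^ Fintype.card F = a) : a ∈ Set.range (algebraMap F K) := by
  classical
  have hcard := FiniteField.X_pow_card_sub_X_natDegree_eq F (Fintype.one_lt_card (α := F))
  have h1 : (Polynomial.X ^ Fintype.card F - Polynomial.X : Polynomial F).Splits := by
    rw [Polynomial.splits_iff_card_roots, FiniteField.roots_X_pow_card_sub_X, hcard]
    rfl
  have h0 := FiniteField.X_pow_card_sub_X_ne_zero K (Fintype.one_lt_card (α := F))
  have h2 : a ∈ (Polynomial.X ^ Fintype.card F - Polynomial.X : Polynomial K).roots := by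
    rw [Polynomial.mem_roots h0]
    simp [ha]
  have h3 := h1.roots_map (algebraMap F K)
  rw [Polynomial.map_sub, Polynomial.map_pow, Polynomial.map_X] at h3
  rw [h3, Multiset.mem_map] at h2
  obtain ⟨c, -, hc⟩ := h2
  exact ⟨c, hc⟩

lemma coeff_mapEquiv {L : Type*} [Field L] (σ : L ≃+* L) (P : MvPolynomial (Fin 3) L) (m : Fin 3 →₀ ℕ) :
    coeff m (mapEquiv (Fin 3) σ P) = σ (coeff m P) := by
  rw [mapEquiv_apply, coeff_map]
  rfl

lemma mem_range_map (σ : K ≃+* K) (hσ : ∀ a, σ a = a ^ Fintype.card F) (P : MvPolynomial (Fin 3) K)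
    (hP : mapEquiv (Fin 3) σ P = P) : ∃ g : MvPolynomial (Fin 3) F, map (algebraMap F K) g = P := by
  have : P ∈ Set.range (map (σ := Fin 3) (algebraMap F K)) := by
    rw [mem_range_map_iff_coeffs_subset]
    intro a ha
    rw [SetLike.mem_coe, mem_coeffs_iff] at ha
    obtain ⟨m, -, rfl⟩ := ha
    apply mem_range_of_pow
    rw [← hσ]
    conv_rhs => rw [← hP]
    rw [coeff_mapEquiv]
  exact this

lemma descend (σ : K ≃+* K) (hσ : ∀ a, σ a = a ^ Fintype.card F) {Φ : MvPolynomial (Fin 3) F}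
    (hσΦ : mapEquiv (Fin 3) σ (map (algebraMap F K) Φ) = map (algebraMap F K) Φ)
    {P : MvPolynomial (Fin 3) K}
    (hP : Irreducible P) (hd : P ∣ map (algebraMap F K) Φ)
    (ha : Associated (mapEquiv (Fin 3) σ P) P) :
    ∃ g : MvPolynomial (Fin 3) F, g ∣ Φ ∧ 0 < g.totalDegree ∧ Irreducible (map (algebraMap F K) g) := by
  obtain ⟨m, hm⟩ := exists_coeff_ne_zero hP.ne_zero
  set P1 := C (coeff m P)⁻¹ * P with hP1
  have hu : IsUnit (C (coeff m P)⁻¹ : MvPolynomial (Fin 3) K) :=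
    (isUnit_iff_ne_zero.2 (inv_ne_zero hm)).map C
  have hass : Associated P1 P := (associated_isUnit_mul_left_iff hu).2 (Associated.refl _) 
  have hc1 : coeff m P1 = 1 := by rw [hP1, coeff_C_mul, inv_mul_cancel₀ hm]
  have hσ1 : Associated (mapEquiv (Fin 3) σ P1) P1 :=
    ((hass.map (mapEquiv (Fin 3) σ)).trans ha).trans hass.symm
  have hfix : mapEquiv (Fin 3) σ P1 = P1 := by
    obtain ⟨u, hu⟩ := hσ1.symm
    obtain ⟨r, hr, hr'⟩ := (isUnit_iff_eq_C_of_isReduced.1 u.isUnit)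
    have := congrArg (coeff m) hu
    rw [hr', mul_comm, coeff_C_mul, hc1] at this
    have h2 : coeff m (mapEquiv (Fin 3) σ P1) = σ (coeff m P1) := coeff_mapEquiv _ _ _
    rw [h2, hc1, map_one, mul_one] at this
    rw [← hu, hr', this, C_1, mul_one]
  have hirr : Irreducible P1 := hass.symm.irreducible hP
  obtain ⟨Q, hQ⟩ := hass.dvd.trans hd
  have hQfix : mapEquiv (Fin 3) σ Q = Q := by
    rw [hQ, map_mul, hfix] at hσΦ
    exact mul_left_cancel₀ hirr.ne_zero hσΦ
  obtain ⟨g, hg⟩ := mem_range_map σ hσ P1 hfix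
  obtain ⟨Q', hQ'⟩ := mem_range_map σ hσ Q hQfix
  refine ⟨g, ⟨Q', ?_⟩, ?_, hg ▸ hirr⟩
  · apply map_injective _ (algebraMap F K).injective
    rw [hQ, map_mul, hg, hQ']
  · rw [Nat.pos_iff_ne_zero]
    intro h0
    rw [totalDegree_eq_zero_iff_eq_C] at h0
    rw [h0, map_C] at hg
    by_cases hz : algebraMap F K (coeff 0 g) = 0
    · rw [hz, C_0] at hg
      exact hirr.ne_zero hg.symm
    · exact hirr.not_isUnit (hg ▸ (isUnit_iff_ne_zero.2 hz).map C)

lemma map_denom : map (algebraMap F K) (denom F) = denom K := by simp [denom]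

lemma map_aeval (s : Fin 3) (f : Polynomial F) : map (algebraMap F K) (Polynomial.aeval (X s) f) =
    Polynomial.aeval (X s : MvPolynomial (Fin 3) K) (f.map (algebraMap F K)) := by
  rw [Polynomial.aeval_def, Polynomial.aeval_def, Polynomial.hom_eval₂, Polynomial.eval₂_map, map_X]
  congr 1
  ext a
  simp [algebraMap_eq]

lemma map_numer (f : Polynomial F) :
    map (algebraMap F K) (numer F f) = numer K (f.map (algebraMap F K)) := by
  simp [numer, map_aeval]

end descent
end PhiAux

/-- If `f ∈ F_q[x]` has positive even degree that is neither `6` nor a power of two,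
then `Φ_f` has an absolutely irreducible factor over `F_q`. -/
theorem Phi_hasAbsIrredFactor (F : Type*) [Field F] [Finite F] (h : ℕ) (hh : 0 < h)
    (hq : Nat.card F = 2 ^ h) (f : Polynomial F)
    (hpos : 0 < f.natDegree) (heven : Even f.natDegree) (h6 : f.natDegree ≠ 6)
    (hpow : ∀ j : ℕ, f.natDegree ≠ 2 ^ j)
    (Φ : MvPolynomial (Fin 3) F) (hΦ : denom F * Φ = numer F f) :
    HasAbsIrredFactor F Φ := by
  classical
  haveI := Fintype.ofFinite F
  haveI hF : CharP F 2 := by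
    obtain ⟨p, hp⟩ := CharP.exists F
    haveI := hp
    obtain ⟨n, hpr, hn⟩ := FiniteField.card F p
    rw [← Nat.card_eq_fintype_card, hq] at hn
    have : p ∣ 2 ^ h := by rw [hn]; exact dvd_pow_self _ n.ne_zero
    have : p = 2 := (Nat.prime_dvd_prime_iff_eq hpr Nat.prime_two).1 (hpr.dvd_of_dvd_pow this)
    rwa [this] at hp
  let K := AlgebraicClosure F
  haveI : CharP K 2 := charP_of_injective_algebraMap (algebraMap F K).injective 2
  obtain ⟨i, l, hl, hil⟩ := Nat.exists_eq_two_pow_mul_odd hpos.ne'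
  have hi : 1 ≤ i := by
    rcases Nat.eq_zero_or_pos i with rfl | hi
    · rw [hil, pow_zero, one_mul] at heven
      exact absurd heven (Nat.not_even_iff_odd.2 hl)
    · exact hi
  have hl3 : 3 ≤ l := by
    have h1 : l ≠ 1 := by
      rintro rfl
      exact hpow i (by rw [hil, mul_one])
    obtain ⟨t, ht⟩ := hl
    omega
  have hne : ¬ (i = 1 ∧ l = 3) := by
    rintro ⟨rfl, rfl⟩
    exact h6 (by rw [hil]; norm_num)
  let τ := FiniteField.frobeniusAlgEquivOfAlgebraic F K
  let σ : K ≃+* K := τ.toRingEquiv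
  have hσ : ∀ a, σ a = a ^ Fintype.card F := fun a => rfl
  have hσΦ : MvPolynomial.mapEquiv (Fin 3) σ (MvPolynomial.map (algebraMap F K) Φ) =
      MvPolynomial.map (algebraMap F K) Φ := by
    ext m
    have h1 : MvPolynomial.coeff m (MvPolynomial.mapEquiv (Fin 3) σ (MvPolynomial.map (algebraMap F K) Φ)) =
        σ (algebraMap F K (MvPolynomial.coeff m Φ)) := by
      rw [PhiAux.coeff_mapEquiv, MvPolynomial.coeff_map]
    rw [h1, MvPolynomial.coeff_map]
    exact τ.commutes _
  have hfK : (f.map (algebraMap F K)).natDegree = 2 ^ i * l := by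
    rw [Polynomial.natDegree_map, hil]
  have hΦK : denom K * MvPolynomial.map (algebraMap F K) Φ = numer K (f.map (algebraMap F K)) := by
    rw [← PhiAux.map_denom (F := F), ← map_mul, hΦ, PhiAux.map_numer]
  obtain ⟨P, hP, hd, ha⟩ := PhiAux.transfer hl hl3 hi hne hfK hΦK σ hσΦ
  exact PhiAux.descend σ hσ hσΦ hP hd ha
end

section
/- Let q be a power of two, let k be an integer with k ≥ 2, and let f ∈ F_q[x] be of the form f(x) = Σ_{i=1}^{2^{k-1}} a_{2i} x^{2i} with a_{2^k} ≠ 0, such that at least one nonzero term of f has degree that is not a power of two. Then Φ_f is absolutely irreducible, i.e., Φ_f is irreducible over the algebraic closure of F_q. -/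
section Aux
open Polynomial

/-- the coefficient of `T^(j+1)` in the numerator, divided by `a_j` -/
noncomputable def MM (K : Type*) [Field K] (j : ℕ) : K[X][X] :=
  C X * ((X + C 1) ^ j + X ^ j) + ((X + C X) ^ j + X ^ j)

/-- degree bound -/
def Bd {K : Type*} [Field K] (b : K[X][X][X]) : Prop :=
  ∀ d i e, ((b.coeff d).coeff i).coeff e ≠ 0 → i + e ≤ d

theorem choose_odd (a m : ℕ) : (Nat.choose (2 ^ a * m) (2 ^ a)) ≡ m [MOD 2] := by
  induction a with
  | zero => simp; rfl
  | succ a ih =>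
    have := @Choose.choose_modEq_choose_mod_mul_choose_div_nat (2 ^ (a+1) * m) (2 ^ (a+1)) 2 _
    have h1 : 2 ^ (a+1) * m = 2 * (2 ^ a * m) := by ring
    have h2 : 2 ^ (a+1) = 2 * 2 ^ a := by ring
    rw [h1, h2] at this ⊢
    simp at this
    exact this.trans ih

theorem choose_cast {K : Type*} [Field K] [CharP K 2] (a m : ℕ) (hm : Odd m) :
    ((Nat.choose (2 ^ a * m) (2 ^ a) : ℕ) : K) = 1 := by
  have h := (CharP.natCast_eq_natCast K 2).2 (choose_odd a m)
  rw [h]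
  obtain ⟨r, rfl⟩ := hm
  push_cast
  rw [CharTwo.two_eq_zero]; ring

theorem MM_coeff {K : Type*} [Field K] [CharP K 2] (j i : ℕ) (hi : 0 < i) (hij : i ≤ j) :
    (MM K j).coeff (j - i) = C ((j.choose i : ℕ) : K) * (X + X ^ i) := by
  have h1 : j - i ≠ j := by omega
  have h2 : j - (j - i) = i := by omega
  have h3 : j.choose (j - i) = j.choose i := Nat.choose_symm hij
  rw [MM, coeff_add, coeff_C_mul, coeff_add, coeff_add, coeff_X_add_C_pow, coeff_X_add_C_pow,
    coeff_X_pow, if_neg h1, h2, h3]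
  simp
  ring

theorem MM_pow {K : Type*} [Field K] [CharP K 2] (k : ℕ) :
    MM K (2 ^ k) = C (X + X ^ (2 ^ k)) := by
  have : CharP K[X][X] 2 := inferInstance
  rw [MM, add_pow_char_pow, add_pow_char_pow]
  have := CharTwo.add_self_eq_zero ((X : K[X][X]) ^ (2 ^ k))
  simp only [map_add, map_pow, map_one, one_pow]
  linear_combination (C X + 1) * this

theorem exists_odd_part (j : ℕ) (hj : j ≠ 0) : ∃ a m, Odd m ∧ j = 2 ^ a * m := by
  obtain ⟨a, m, h, rfl⟩ := Nat.exists_eq_two_pow_mul_odd hj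
  exact ⟨a, m, h, rfl⟩

theorem dvd_step {K : Type*} [Field K] (p0 q0 : K[X]) (A B : K[X][X]) (h : IsCoprime p0 q0)
    (hAB : C p0 * A + B * C q0 = 0) (hd : ∀ i, (A.coeff i) ≠ 0 → (A.coeff i).natDegree < q0.natDegree) :
    A = 0 := by
  ext1 i
  by_contra hne
  have h1 : q0 ∣ p0 * A.coeff i := by
    have := congrArg (fun x => x.coeff i) hAB
    simp only [coeff_add, coeff_C_mul, coeff_mul_C, coeff_zero] at this
    exact ⟨- B.coeff i, by linear_combination this⟩
  have h2 := h.symm.dvd_of_dvd_mul_left h1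
  exact absurd (natDegree_le_of_dvd h2 hne) (not_le.2 (hd i hne))

theorem sep_aux {K : Type*} [Field K] [CharP K 2] (n : ℕ) (hn : ((n : ℕ) : K) = 0) (c : K)
    (hc : c ≠ 0) : (C c * (X + X ^ n) : K[X]).Separable := by
  have h1 : (X + X ^ n : K[X]).Separable := by
    have h2 : derivative (X + X ^ n : K[X]) = 1 := by
      rw [derivative_add, derivative_X, derivative_X_pow, hn, C_0, zero_mul, add_zero]
    rw [Separable, h2]
    exact isCoprime_one_right
  exact h1.unit_mul (isUnit_C.2 (isUnit_iff_ne_zero.2 hc))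

set_option maxHeartbeats 4000000 in
theorem core {K : Type*} [Field K] [IsAlgClosed K] [CharP K 2] (k : ℕ) (hk : 2 ≤ k) (a : ℕ → K)
    (ha : ∀ i, a i ≠ 0 → Even i ∧ 0 < i ∧ i ≤ 2 ^ k) (hl : a (2 ^ k) ≠ 0)
    (hnp : ∃ i : ℕ, a i ≠ 0 ∧ ∀ j : ℕ, i ≠ 2 ^ j)
    (p q : K[X][X][X]) (hp : Bd p) (hq : Bd q)
    (hφ : ∀ d, (p * q).coeff d * C (X * (X + 1)) = C (C (a (d + 2))) * MM K (d + 2))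
    (hst : q.natDegree ≤ p.natDegree) (ht : 0 < q.natDegree) : False := by
  obtain ⟨n, hn⟩ : ∃ n, n = 2 ^ k := ⟨_, rfl⟩
  have hn4 : 4 ≤ n := by
    rw [hn]; calc 4 = 2 ^ 2 := rfl
      _ ≤ 2 ^ k := Nat.pow_le_pow_right (by norm_num) hk
  rw [← hn] at ha hl
  have hUU : (C (X * (X + 1)) : K[X][X]) ≠ 0 := by
    rw [Ne, C_eq_zero]
    exact mul_ne_zero X_ne_zero (X_add_C_ne_zero 1)
  have hq0 : q ≠ 0 := by rintro rfl; simp at ht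
  have hp0 : p ≠ 0 := by rintro rfl; simp at hst; omega
  -- separable
  have hsep : (C (a n) * (X + X ^ n) : K[X]).Separable := by
    refine sep_aux n ?_ _ hl
    rw [hn]; push_cast; rw [CharTwo.two_eq_zero, zero_pow (by omega)]
  have hpn : (C (a n) * (X + X ^ n) : K[X]).natDegree = n := by
    rw [natDegree_C_mul hl, add_comm, natDegree_add_eq_left_of_natDegree_lt] <;> simp
    omega
  have htop := hφ (n - 2)
  rw [Nat.sub_add_cancel (by omega : 2 ≤ n), hn, MM_pow, ← hn, ← C_mul] at htop
  have hdeg : p.natDegree + q.natDegree = n - 2 := by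
    rw [← natDegree_mul hp0 hq0]
    apply natDegree_eq_of_le_of_coeff_ne_zero
    · rw [natDegree_le_iff_coeff_eq_zero]
      intro d hd
      have : a (d + 2) = 0 := by
        by_contra h
        have := (ha _ h).2.2
        omega
      have h1 := hφ d
      rw [this] at h1
      rw [C_0, C_0, zero_mul] at h1
      exact (mul_eq_zero.1 h1).resolve_right hUU
    · intro h0
      rw [h0, zero_mul] at htop
      have := C_eq_zero.1 htop.symm
      rw [this] at hpn
      simp at hpn; omega
  -- leading coefficients
  have hlc : p.leadingCoeff * q.leadingCoeff * C (X * (X + 1)) = C (C (a n) * (X + X ^ n)) := by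
    rw [← leadingCoeff_mul, leadingCoeff, natDegree_mul hp0 hq0, hdeg, htop]
  have hplc : p.leadingCoeff ≠ 0 := leadingCoeff_ne_zero.2 hp0
  have hqlc : q.leadingCoeff ≠ 0 := leadingCoeff_ne_zero.2 hq0
  have hnat : p.leadingCoeff.natDegree + q.leadingCoeff.natDegree = 0 := by
    have := congrArg natDegree hlc
    rw [natDegree_mul (mul_ne_zero hplc hqlc) hUU, natDegree_mul hplc hqlc, natDegree_C,
      natDegree_C] at this
    omega
  obtain ⟨p0, hp0'⟩ := natDegree_eq_zero.1 (by omega : p.leadingCoeff.natDegree = 0)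
  obtain ⟨q0, hq0'⟩ := natDegree_eq_zero.1 (by omega : q.leadingCoeff.natDegree = 0)
  rw [← hp0', ← hq0', ← C_mul, ← C_mul] at hlc
  have hlc0 := C_injective hlc
  have hp00 : p0 ≠ 0 := by rintro rfl; rw [C_0] at hp0'; exact hplc hp0'.symm
  have hq00 : q0 ≠ 0 := by rintro rfl; rw [C_0] at hq0'; exact hqlc hq0'.symm
  have hbp : p0.natDegree ≤ p.natDegree := by
    have := hp p.natDegree 0 p0.natDegree (by
      rw [coeff_natDegree, ← hp0', coeff_C_zero]; exact leadingCoeff_ne_zero.2 hp00)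
    omega
  have hbq : q0.natDegree ≤ q.natDegree := by
    have := hq q.natDegree 0 q0.natDegree (by
      rw [coeff_natDegree, ← hq0', coeff_C_zero]; exact leadingCoeff_ne_zero.2 hq00)
    omega
  have hdd : p0.natDegree + q0.natDegree + 2 = n := by
    have := congrArg natDegree hlc0
    have hX1 : (X + 1 : K[X]) ≠ 0 := X_add_C_ne_zero 1
    rw [hpn, natDegree_mul (mul_ne_zero hp00 hq00) (mul_ne_zero X_ne_zero hX1),
      natDegree_mul hp00 hq00, natDegree_mul X_ne_zero hX1, natDegree_X] at this
    have h1 : (X + 1 : K[X]).natDegree = 1 := natDegree_X_add_C 1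
    omega
  have hq0d : q0.natDegree = q.natDegree := by omega
  have hp0d : p0.natDegree = p.natDegree := by omega
  have hcop : IsCoprime p0 q0 := by
    rw [← hlc0] at hsep
    exact hsep.of_mul_left.isCoprime
  have hcop2 : IsCoprime (p0 * q0) (X * (X + 1)) := by
    rw [← hlc0] at hsep
    exact hsep.isCoprime
  -- reverse
  obtain ⟨s, hs⟩ : ∃ s, s = p.natDegree := ⟨_, rfl⟩
  obtain ⟨t, htt⟩ : ∃ t, t = q.natDegree := ⟨_, rfl⟩
  rw [← hs] at hdeg hp0d hst
  rw [← htt] at hdeg hq0d hst ht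
  have rev : ∀ b : K[X][X][X], Bd b → ∀ m i e, ((b.reverse.coeff m).coeff i).coeff e ≠ 0 →
      m + i + e ≤ b.natDegree := by
    intro b hb m i e h
    rw [coeff_reverse] at h
    by_cases hm : m ≤ b.natDegree
    · rw [revAt_le hm] at h
      have := hb _ _ _ h
      omega
    · rw [revAt_eq_self_of_lt (by omega)] at h
      rw [coeff_eq_zero_of_natDegree_lt (p := b) (n := m) (by omega)] at h
      simp at h
  have hP := rev p hp
  have hQ := rev q hq
  rw [← hs] at hP
  rw [← htt] at hQ
  have hPQ : p.reverse * q.reverse = (p * q).reverse := (reverse_mul_of_domain p q).symm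
  have hF : ∀ m, m ≤ n - 2 → (p.reverse * q.reverse).coeff m * C (X * (X + 1)) =
      C (C (a (n - m))) * MM K (n - m) := by
    intro m hm
    rw [hPQ, coeff_reverse, natDegree_mul hp0 hq0, ← hs, ← htt, hdeg, revAt_le hm, hφ]
    rw [show n - 2 - m + 2 = n - m by omega]
  have hF0 : ∀ m, n - 2 < m → (p.reverse * q.reverse).coeff m = 0 := by
    intro m hm
    rw [hPQ, coeff_reverse, natDegree_mul hp0 hq0, ← hs, ← htt, hdeg, revAt_eq_self_of_lt hm,
      coeff_eq_zero_of_natDegree_lt]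
    rw [natDegree_mul hp0 hq0, ← hs, ← htt, hdeg]; exact hm
  have hP0 : p.reverse.coeff 0 = C p0 := by rw [coeff_zero_reverse, hp0']
  have hQ0 : q.reverse.coeff 0 = C q0 := by rw [coeff_zero_reverse, hq0']
  generalize p.reverse = P at *
  generalize q.reverse = Q at *
  clear rev hPQ
  -- J
  obtain ⟨j0, hj0, hj0p⟩ := hnp
  have hj0n : j0 < n := lt_of_le_of_ne (ha _ hj0).2.2 (by rw [hn]; exact hj0p k)
  classical
  obtain ⟨J, hJ0, hJn, hJmax⟩ : ∃ J, a J ≠ 0 ∧ J < n ∧ ∀ j, J < j → j < n → a j = 0 := by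
    have hPr : a j0 ≠ 0 ∧ j0 < n := ⟨hj0, hj0n⟩
    refine ⟨Nat.findGreatest (fun j => a j ≠ 0 ∧ j < n) n, ?_, ?_, ?_⟩
    · exact (Nat.findGreatest_spec (P := fun j => a j ≠ 0 ∧ j < n) hj0n.le hPr).1
    · exact (Nat.findGreatest_spec (P := fun j => a j ≠ 0 ∧ j < n) hj0n.le hPr).2
    · intro j hj hjn
      by_contra h
      exact Nat.findGreatest_is_greatest hj hjn.le ⟨h, hjn⟩
  have hJpos := (ha J hJ0).2.1
  have hJev := (ha J hJ0).1
  have hJ2 : 2 ≤ J := by obtain ⟨r, hr⟩ := hJev; omega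
  -- claim 1
  have claim1 : ∀ m, 0 < m → m < n - J → P.coeff m = 0 ∧ Q.coeff m = 0 := by
    intro m
    induction m using Nat.strong_induction_on with
    | _ m ih =>
    intro hm0 hm
    have hz : (P * Q).coeff m = 0 := by
      by_cases hm2 : m ≤ n - 2
      · have h1 := hF m hm2
        rw [hJmax (n - m) (by omega) (by omega)] at h1
        rw [C_0, C_0, zero_mul] at h1
        exact (mul_eq_zero.1 h1).resolve_right hUU
      · exact hF0 m (by omega)
    have hsum : (P * Q).coeff m = C p0 * Q.coeff m + P.coeff m * C q0 := by
      rw [coeff_mul, Finset.Nat.sum_antidiagonal_eq_sum_range_succ (fun i j => P.coeff i * Q.coeff j),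
        Finset.sum_range_succ, Finset.sum_eq_single 0]
      · simp [hP0, hQ0]
      · intro i hi hi0
        rw [(ih i (by simpa using hi) (by omega) (by have := Finset.mem_range.1 hi; omega)).1, zero_mul]
      · intro h; simp at h; omega
    rw [hsum] at hz
    constructor
    · refine dvd_step q0 p0 (P.coeff m) (Q.coeff m) hcop.symm (by rw [← hz]; ring) ?_
      intro i hi
      have := hP m i _ (leadingCoeff_ne_zero.2 hi)
      omega
    · refine dvd_step p0 q0 (Q.coeff m) (P.coeff m) hcop hz ?_
      intro i hi
      have := hQ m i _ (leadingCoeff_ne_zero.2 hi)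
      omega
  -- claim 3
  have claim3 : t < n - J := by
    obtain ⟨b, m, hm, hJm⟩ := exists_odd_part J (by omega)
    by_contra hcon
    have hbk : b < k := by
      by_contra h
      have h1 : 2 ^ k ≤ 2 ^ b := Nat.pow_le_pow_right (by norm_num) (by omega)
      have : 2 ^ b ≤ J := by rw [hJm]; exact Nat.le_mul_of_pos_right _ hm.pos
      omega
    by_cases hm1 : m = 1
    · have h1 : 2 ^ b * 2 ≤ 2 ^ k := by
        rw [← pow_succ]; exact Nat.pow_le_pow_right (by norm_num) (by omega)
      rw [hm1, mul_one] at hJm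
      omega
    · have hb0 : b ≠ 0 := by
        rintro rfl
        rw [hJm] at hJev
        simp at hJev
        exact (Nat.not_even_iff_odd.2 hm) hJev
      have hl2 : 2 ≤ 2 ^ b := by
        calc 2 = 2 ^ 1 := rfl
          _ ≤ 2 ^ b := Nat.pow_le_pow_right (by norm_num) (by omega)
      have hle : 2 ^ b ≤ n - J := by
        apply Nat.le_of_dvd (by omega)
        apply Nat.dvd_sub
        · rw [hn]; exact pow_dvd_pow 2 hbk.le
        · exact ⟨m, hJm⟩
      have hlJ : 2 ^ b ≤ J := by rw [hJm]; exact Nat.le_mul_of_pos_right _ hm.pos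
      have hsum : (P * Q).coeff (n - J) = C p0 * Q.coeff (n - J) + P.coeff (n - J) * C q0 := by
        rw [coeff_mul, Finset.Nat.sum_antidiagonal_eq_sum_range_succ (fun i j => P.coeff i * Q.coeff j),
          Finset.sum_range_succ, Finset.sum_eq_single 0]
        · simp [hP0, hQ0]
        · intro i hi hi0
          rw [(claim1 i (by omega) (by simpa using hi)).1, zero_mul]
        · intro h; simp at h; omega
      have hPz : (P.coeff (n - J)).coeff (J - 2 ^ b) = 0 := by
        by_contra h
        have := hP _ _ _ (leadingCoeff_ne_zero.2 h)
        omega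
      have hQz : (Q.coeff (n - J)).coeff (J - 2 ^ b) = 0 := by
        by_contra h
        have := hQ _ _ _ (leadingCoeff_ne_zero.2 h)
        omega
      have h1 := hF (n - J) (by omega)
      rw [hsum, show n - (n - J) = J by omega] at h1
      have h2 := congrArg (fun x => x.coeff (J - 2 ^ b)) h1
      simp only [coeff_mul_C, coeff_C_mul, coeff_add, hPz, hQz] at h2
      rw [MM_coeff _ _ (by omega) hlJ] at h2
      have h3 : ((J.choose (2 ^ b) : ℕ) : K) = 1 := by
        rw [hJm]; exact choose_cast b m hm
      rw [h3] at h2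
      simp at h2
      rcases h2 with h2 | h2
      · exact hJ0 h2
      · have := congrArg (fun x => x.coeff 1) h2
        have hne : (1 : ℕ) ≠ 2 ^ b := by omega
        simp [coeff_X_pow, -Nat.pow_eq_one, hne] at this
  -- claim 4
  have hQC : Q = C (C q0) := by
    ext1 m
    rcases Nat.eq_zero_or_pos m with rfl | hm
    · rw [hQ0, coeff_C_zero]
    · rw [coeff_C_of_ne_zero hm.ne']
      by_cases hmt : m ≤ t
      · exact (claim1 m hm (by omega)).2
      · by_contra h
        have h1 := leadingCoeff_ne_zero.2 (leadingCoeff_ne_zero.2 h)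
        have := hQ _ _ _ h1
        omega
  obtain ⟨α, hα⟩ := IsAlgClosed.exists_root q0 (by
    intro h
    have := natDegree_eq_zero_iff_degree_le_zero.2 h.le
    omega)
  have hα' : α * (α + 1) ≠ 0 := by
    intro h
    obtain ⟨x, y, hxy⟩ := hcop2
    have := congrArg (eval α) hxy
    simp only [eval_add, eval_mul, eval_X, eval_one, h, hα.eq_zero] at this
    simp at this
  have hj02 : 2 ≤ j0 := by obtain ⟨r, hr⟩ := (ha j0 hj0).1; have := (ha j0 hj0).2.1; omega
  have key : ∀ i, 0 < i → i ≤ j0 → ((j0.choose i : ℕ) : K) = 1 → α + α ^ i = 0 := by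
    intro i hi hij hc
    have h1 := hF (n - j0) (by omega)
    rw [hQC, coeff_mul_C, show n - (n - j0) = j0 by omega] at h1
    have h2 := congrArg (fun x => (x.coeff (j0 - i)).eval α) h1
    simp only [coeff_mul_C, coeff_C_mul] at h2
    rw [MM_coeff _ _ hi hij, hc] at h2
    simp [hα.eq_zero, hj0] at h2
    exact h2
  obtain ⟨b, m, hm, hjm⟩ := exists_odd_part j0 (by omega)
  have hm1 : m ≠ 1 := by rintro rfl; exact hj0p b (by simpa using hjm)
  have hlt : 2 ^ b < j0 := by
    rw [hjm]
    have : 0 < 2 ^ b := by positivity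
    have := hm.pos
    have h2m : 2 ≤ m := by omega
    nlinarith
  have hch : ((j0.choose (2 ^ b) : ℕ) : K) = 1 := by rw [hjm]; exact choose_cast b m hm
  have k1 := key (2 ^ b) (by positivity) hlt.le hch
  have k2 := key (j0 - 2 ^ b) (Nat.sub_pos_of_lt hlt) (Nat.sub_le _ _) (by rw [Nat.choose_symm hlt.le]; exact hch)
  have k3 := key j0 (by omega) le_rfl (by simp)
  have k4 : α ^ j0 = α ^ (2 ^ b) * α ^ (j0 - 2 ^ b) := by
    rw [← pow_add, Nat.add_sub_cancel' hlt.le]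
  rw [CharTwo.add_eq_zero] at k1 k2 k3
  rw [← k1, ← k2, ← k3] at k4
  apply hα'
  rw [mul_add, ← k4, mul_one]
  exact CharTwo.add_self_eq_zero α

/-- weighted substitution -/
noncomputable def Psi (K : Type*) [Field K] : MvPolynomial (Fin 3) K →ₐ[K] K[X][X][X] :=
  MvPolynomial.aeval ((![C (C X) * X, X, C X * X] : Fin 3 → K[X][X][X]))

/-- change of coordinates -/
noncomputable def Sg (K : Type*) [Field K] : MvPolynomial (Fin 3) K →ₐ[K] MvPolynomial (Fin 3) K :=
  MvPolynomial.aeval ![MvPolynomial.X 0 + MvPolynomial.X 2, MvPolynomial.X 1 + MvPolynomial.X 2,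
    MvPolynomial.X 2]

theorem Sg_Sg {K : Type*} [Field K] [CharP K 2] (P : MvPolynomial (Fin 3) K) :
    Sg K (Sg K P) = P := by
  have h2 : ((Sg K).comp (Sg K)) = AlgHom.id K _ := by
    apply MvPolynomial.algHom_ext
    intro i
    have h := CharTwo.add_self_eq_zero (MvPolynomial.X 2 : MvPolynomial (Fin 3) K)
    fin_cases i
    · simp [Sg, add_assoc, h]
    · simp [Sg, add_assoc, h]
    · simp [Sg]
  exact DFunLike.congr_fun h2 P

theorem Psi_monomial {K : Type*} [Field K] (m : Fin 3 →₀ ℕ) (c : K) :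
    Psi K (MvPolynomial.monomial m c) =
      monomial (m 0 + m 1 + m 2) (monomial (m 2) (monomial (m 0) c)) := by
  rw [Psi, MvPolynomial.aeval_monomial]
  rw [Finsupp.prod_fintype _ _ (by simp), Fin.prod_univ_three]
  change algebraMap K K[X][X][X] c * ((C (C X) * X) ^ m 0 * X ^ m 1 * (C X * X) ^ m 2) = _
  simp only [← C_mul_X_pow_eq_monomial, mul_pow, C_mul, C_pow, pow_add]
  have : algebraMap K K[X][X][X] c = C (C (C c)) := rfl
  rw [this]
  ring

theorem Bd_Psi {K : Type*} [Field K] (P : MvPolynomial (Fin 3) K) : Bd (Psi K P) := by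
  induction P using MvPolynomial.induction_on' with
  | monomial m c =>
    intro d i e h
    rw [Psi_monomial] at h
    simp only [coeff_monomial] at h
    split_ifs at h with h1
    · rw [coeff_monomial] at h
      split_ifs at h with h2
      · rw [coeff_monomial] at h
        split_ifs at h with h3
        · omega
        · simp at h
      · simp at h
    · simp at h
  | add p q hp hq =>
    intro d i e h
    rw [map_add, coeff_add, coeff_add, coeff_add] at h
    by_cases h1 : (((Psi K p).coeff d).coeff i).coeff e = 0
    · rw [h1, zero_add] at h
      exact hq _ _ _ h
    · exact hp _ _ _ h1

theorem Psi_coeff {K : Type*} [Field K] (P : MvPolynomial (Fin 3) K) (m : Fin 3 →₀ ℕ) :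
    (((Psi K P).coeff (m 0 + m 1 + m 2)).coeff (m 2)).coeff (m 0) = P.coeff m := by
  induction P using MvPolynomial.induction_on' with
  | monomial m' c =>
    rw [Psi_monomial, MvPolynomial.coeff_monomial]
    split_ifs with h
    · subst h
      simp
    · simp only [coeff_monomial]
      split_ifs with h1
      · rw [coeff_monomial]
        split_ifs with h2
        · rw [coeff_monomial]
          split_ifs with h3
          · exfalso
            apply h
            ext i
            fin_cases i
            · exact h3
            · simp; omega
            · exact h2
          · rfl
        · simp
      · simp
  | add p q hp hq =>
    rw [map_add, coeff_add, coeff_add, coeff_add, hp, hq, MvPolynomial.coeff_add]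

theorem const_of_natDegree {K : Type*} [Field K] [CharP K 2] (P : MvPolynomial (Fin 3) K)
    (h : (Psi K (Sg K P)).natDegree = 0) (hP : P ≠ 0) : IsUnit P := by
  have h1 : Sg K P = MvPolynomial.C ((Sg K P).coeff 0) := by
    ext m
    rw [MvPolynomial.coeff_C]
    split_ifs with hm
    · rw [← hm]
    · rw [← Psi_coeff, coeff_eq_zero_of_natDegree_lt (p := Psi K (Sg K P))]
      · simp
      · rw [h]
        by_contra hc
        apply hm
        ext i
        fin_cases i
        · change 0 = m 0; omega
        · change 0 = m 1; omega
        · change 0 = m 2; omega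
  have h2 := congrArg (Sg K) h1
  rw [Sg_Sg] at h2
  generalize (Sg K P).coeff 0 = c at h2
  have h3 : P = MvPolynomial.C c := by
    rw [h2]; simp [Sg]
  rw [h3] at hP ⊢
  apply IsUnit.map
  rw [isUnit_iff_ne_zero]
  intro h0
  rw [h0] at hP
  simp at hP

theorem aeval_coeff {K : Type*} [Field K] (f : K[X]) (b : K[X][X]) (j : ℕ) :
    (aeval (C b * X : K[X][X][X]) f).coeff j = C (C (f.coeff j)) * b ^ j := by
  have h1 : aeval (C b * X : K[X][X][X]) f = (f.map (algebraMap K K[X][X])).comp (C b * X) := by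
    rw [comp, eval₂_map, aeval_def]; rfl
  rw [h1, comp_C_mul_X_coeff, coeff_map]
  rfl

theorem Psi_denom {K : Type*} [Field K] [CharP K 2] :
    Psi K (Sg K (denom K)) = C (C (X * (X + 1))) * X ^ 3 := by
  have hs : Sg K (denom K) = (MvPolynomial.X 0 + MvPolynomial.X 1) * MvPolynomial.X 0 *
      MvPolynomial.X 1 := by
    have h := CharTwo.add_self_eq_zero (MvPolynomial.X 2 : MvPolynomial (Fin 3) K)
    simp only [denom, Sg, map_mul, map_add, MvPolynomial.aeval_X, Matrix.cons_val_zero,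
      Matrix.cons_val_one, Matrix.cons_val]
    linear_combination (((MvPolynomial.X 0 + MvPolynomial.X 2 + (MvPolynomial.X 1 + MvPolynomial.X 2)) * (MvPolynomial.X 0 + MvPolynomial.X 2 + MvPolynomial.X 2) * 1
      + MvPolynomial.X 1 * (MvPolynomial.X 0 + MvPolynomial.X 2 + MvPolynomial.X 2)
      + MvPolynomial.X 1 * (MvPolynomial.X 0 + MvPolynomial.X 1)) : MvPolynomial (Fin 3) K) * h
  rw [hs, Psi]
  simp only [map_mul, map_add, MvPolynomial.aeval_X, Matrix.cons_val_zero,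
      Matrix.cons_val_one, map_one]
  ring

theorem Psi_numer_coeff {K : Type*} [Field K] [CharP K 2] (f : K[X]) (j : ℕ) :
    (Psi K (Sg K (numer K f))).coeff (j + 1) = C (C (f.coeff j)) * MM K j := by
  have h0 : Psi K (Sg K (MvPolynomial.X 0)) = C (X + C X) * X := by
    simp [Psi, Sg]; ring
  have h1 : Psi K (Sg K (MvPolynomial.X 1)) = C (X + C 1) * X := by
    simp [Psi, Sg]; ring
  have h2 : Psi K (Sg K (MvPolynomial.X 2)) = C X * X := by
    simp [Psi, Sg]
  have ha : ∀ g : MvPolynomial (Fin 3) K, Psi K (Sg K (aeval g f)) = aeval (Psi K (Sg K g)) f := by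
    intro g
    rw [← aeval_algHom_apply, ← aeval_algHom_apply]
  simp only [numer, map_add, map_mul, ha, h0, h1, h2]
  simp only [coeff_add, mul_assoc, coeff_C_mul, coeff_X_mul, aeval_coeff, ← C_add]
  have e1 := CharTwo.add_self_eq_zero (X : K[X][X])
  have e2 := CharTwo.add_self_eq_zero ((X + C 1 : K[X][X]) ^ j)
  have e3 := CharTwo.add_self_eq_zero ((X + C X : K[X][X]) ^ j)
  have e4 := CharTwo.add_self_eq_zero ((X : K[X][X]) ^ j)
  rw [MM]
  simp only [C_1] at *
  linear_combination C (C (f.coeff j)) * X * (e2 + e3 + e4)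

theorem main_aux {K : Type*} [Field K] [IsAlgClosed K] [CharP K 2] (k : ℕ) (hk : 2 ≤ k) (f : K[X])
    (ha : ∀ i, f.coeff i ≠ 0 → Even i ∧ 0 < i ∧ i ≤ 2 ^ k) (hl : f.coeff (2 ^ k) ≠ 0)
    (hnp : ∃ i : ℕ, f.coeff i ≠ 0 ∧ ∀ j : ℕ, i ≠ 2 ^ j)
    (Φ : MvPolynomial (Fin 3) K) (hΦ : denom K * Φ = numer K f) : Irreducible Φ := by
  have hφ : ∀ d, (Psi K (Sg K Φ)).coeff d * C (X * (X + 1)) =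
      C (C (f.coeff (d + 2))) * MM K (d + 2) := by
    intro d
    rw [← Psi_numer_coeff, ← hΦ, map_mul (Sg K), map_mul (Psi K), Psi_denom, mul_assoc, coeff_C_mul,
      show d + 2 + 1 = d + 3 from rfl, coeff_X_pow_mul, mul_comm]
  have hn4 : 4 ≤ 2 ^ k := by
    calc 4 = 2 ^ 2 := rfl
      _ ≤ 2 ^ k := Nat.pow_le_pow_right (by norm_num) hk
  have htop : (Psi K (Sg K Φ)).coeff (2 ^ k - 2) ≠ 0 := by
    intro h0
    have h1 := hφ (2 ^ k - 2)
    rw [h0, Nat.sub_add_cancel (by omega : 2 ≤ 2 ^ k), MM_pow, zero_mul, ← C_mul] at h1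
    have h2 := congrArg (fun x => x.coeff 1) (C_eq_zero.1 h1.symm)
    have hne : (1 : ℕ) ≠ 2 ^ k := by omega
    rw [coeff_C_mul, coeff_add, coeff_X_one, coeff_X_pow, if_neg hne, add_zero, mul_one,
      coeff_zero] at h2
    exact hl h2
  have hΦ0 : Φ ≠ 0 := by
    rintro rfl
    simp at htop
  refine ⟨?_, ?_⟩
  · intro hu
    have h1 := natDegree_eq_zero_of_isUnit ((hu.map (Sg K)).map (Psi K))
    exact htop (coeff_eq_zero_of_natDegree_lt (by omega))
  · intro P Q hPQ
    by_contra hcon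
    push Not at hcon
    have hP0 : P ≠ 0 := by rintro rfl; exact hΦ0 (by rw [hPQ, zero_mul])
    have hQ0 : Q ≠ 0 := by rintro rfl; exact hΦ0 (by rw [hPQ, mul_zero])
    have hPd : 0 < (Psi K (Sg K P)).natDegree :=
      Nat.pos_of_ne_zero fun h => hcon.1 (const_of_natDegree P h hP0)
    have hQd : 0 < (Psi K (Sg K Q)).natDegree :=
      Nat.pos_of_ne_zero fun h => hcon.2 (const_of_natDegree Q h hQ0)
    rw [hPQ, map_mul, map_mul] at hφ
    rcases le_total (Psi K (Sg K Q)).natDegree (Psi K (Sg K P)).natDegree with h | h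
    · exact core k hk f.coeff ha hl hnp _ _ (Bd_Psi _) (Bd_Psi _) hφ h hQd
    · refine core k hk f.coeff ha hl hnp _ _ (Bd_Psi _) (Bd_Psi _) ?_ h hPd
      intro d
      rw [mul_comm (Psi K (Sg K Q))]
      exact hφ d

theorem map_denom (F L : Type*) [Field F] [Field L] (g : F →+* L) :
    MvPolynomial.map g (denom F) = denom L := by
  simp [denom]

theorem map_numer (F L : Type*) [Field F] [Field L] (g : F →+* L) (f : F[X]) :
    MvPolynomial.map g (numer F f) = numer L (f.map g) := by
  have h : ∀ i : Fin 3, MvPolynomial.map g (aeval (MvPolynomial.X i) f) =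
      aeval (MvPolynomial.X i) (f.map g) := by
    intro i
    rw [aeval_def, hom_eval₂, aeval_def, eval₂_map]
    congr 1
    · ext x; simp [MvPolynomial.algebraMap_eq]
    · simp
  simp only [numer, map_add, map_mul, h, MvPolynomial.map_X]

end Aux

/-- Let `k ≥ 2` and let `f ∈ F_q[x]` be of the form `f(x) = Σ_{i=1}^{2^(k-1)} a_{2i} x^{2i}`
(i.e. every term of `f` has positive even degree at most `2^k`) with `a_{2^k} ≠ 0`, such
that the degree of at least one term of `f` is not a power of two. Then `Φ_f` is
absolutely irreducible. -/
theorem Phi_absolutely_irreducible (F : Type*) [Field F] [Finite F] (h k : ℕ)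
    (hh : 0 < h) (hq : Nat.card F = 2 ^ h) (hk : 2 ≤ k) (f : Polynomial F)
    (hform : ∀ i : ℕ, f.coeff i ≠ 0 → Even i ∧ 0 < i ∧ i ≤ 2 ^ k)
    (hlead : f.coeff (2 ^ k) ≠ 0)
    (hnp : ∃ i : ℕ, f.coeff i ≠ 0 ∧ ∀ j : ℕ, i ≠ 2 ^ j)
    (Φ : MvPolynomial (Fin 3) F) (hΦ : denom F * Φ = numer F f) :
    Irreducible (MvPolynomial.map (algebraMap F (AlgebraicClosure F)) Φ) := by
  have h2 : CharP F 2 := by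
    obtain ⟨p, hp⟩ := CharP.exists F
    have : Fintype F := Fintype.ofFinite F
    have hpr : p.Prime := CharP.char_is_prime F p
    have hdvd : p ∣ 2 ^ h := by
      rw [← hq, Nat.card_eq_fintype_card, ← CharP.cast_eq_zero_iff F p]
      exact Nat.cast_card_eq_zero F
    have : p = 2 := (Nat.prime_dvd_prime_iff_eq hpr Nat.prime_two).1 (hpr.dvd_of_dvd_pow hdvd)
    rwa [this] at hp
  have : CharP (AlgebraicClosure F) 2 := charP_of_injective_algebraMap
    (algebraMap F (AlgebraicClosure F)).injective 2
  have hc : ∀ i, (f.map (algebraMap F (AlgebraicClosure F))).coeff i ≠ 0 ↔ f.coeff i ≠ 0 := by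
    intro i
    rw [Polynomial.coeff_map, Ne, map_eq_zero]
  refine main_aux k hk (f.map (algebraMap F (AlgebraicClosure F))) ?_ ?_ ?_ _ ?_
  · intro i hi
    exact hform i ((hc i).1 hi)
  · exact (hc _).2 hlead
  · obtain ⟨i, hi, hj⟩ := hnp
    exact ⟨i, (hc i).2 hi, hj⟩
  · rw [← map_denom F, ← map_mul, hΦ, map_numer]
end

section
/- Let h and k be positive integers with 2^k ≤ 2^h - 1 and let q = 2^h. The monomial x^{2^k} is an o-polynomial of F_q if and only if k and h are coprime. -/
open Polynomial

/-- An o-polynomial of a finite field `F`: a polynomial of degree at most `|F| - 1`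
inducing a permutation of `F` with `f(0) = 0`, `f(1) = 1`, such that no three points
of the graph of `f` are collinear. -/
def IsOPoly (F : Type*) [Field F] [Finite F] (f : F[X]) : Prop :=
  f.natDegree ≤ Nat.card F - 1 ∧
  Function.Bijective (fun x : F => f.eval x) ∧
  f.eval 0 = 0 ∧ f.eval 1 = 1 ∧
  ∀ a b c : F, a ≠ b → a ≠ c → b ≠ c →
    Matrix.det !![1, 1, 1; a, b, c; f.eval a, f.eval b, f.eval c] ≠ 0

/-- Two polynomials `f`, `g` are equivalent if
`g(x) = (f(x+a) + f(a)) / (f(1+a) + f(a))` for some `a ∈ F`. -/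
def OEquiv (F : Type*) [Field F] (f g : F[X]) : Prop :=
  ∃ a : F, g = Polynomial.C (f.eval (1 + a) + f.eval a)⁻¹ *
    (f.comp (Polynomial.X + Polynomial.C a) + Polynomial.C (f.eval a))

/-- For `q = 2^h` and `2^k ≤ 2^h - 1`, the monomial `x^(2^k)` is an o-polynomial of
`F_q` iff `k` and `h` are coprime. -/
theorem opoly_x_pow_two_pow_iff (F : Type*) [Field F] [Finite F] (h k : ℕ)
    (hh : 0 < h) (hk : 0 < k) (hle : 2 ^ k ≤ 2 ^ h - 1) (hq : Nat.card F = 2 ^ h) :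
    IsOPoly F (X ^ (2 ^ k) : F[X]) ↔ Nat.Coprime k h := by
  classical
  haveI := Fintype.ofFinite F
  have hcard : Fintype.card F = 2 ^ h := by rw [← Nat.card_eq_fintype_card, hq]
  have h2 : (2 : F) = 0 := by
    have h1 := FiniteField.cast_card_eq_zero F
    rw [hcard] at h1
    push_cast at h1
    exact pow_eq_zero_iff (by omega) |>.1 h1
  haveI : CharP F 2 := CharTwo.of_one_ne_zero_of_two_eq_zero one_ne_zero h2
  haveI : Fact (Nat.Prime 2) := ⟨Nat.prime_two⟩
  have hk1 : 1 ≤ 2 ^ k := Nat.one_le_two_pow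
  have hU : Nat.card Fˣ = 2 ^ h - 1 := by
    rw [Nat.card_units, hq]
  have hgcd : Nat.gcd (2 ^ k - 1) (2 ^ h - 1) = 2 ^ (Nat.gcd k h) - 1 :=
    Nat.pow_sub_one_gcd_pow_sub_one 2 k h
  constructor
  · rintro ⟨-, -, -, -, hdet⟩
    by_contra hc
    have hd0 : 0 < Nat.gcd k h := Nat.gcd_pos_of_pos_left _ hk
    have hd : 2 ≤ Nat.gcd k h := by
      have : Nat.gcd k h ≠ 1 := hc
      omega
    have h4 : 2 ^ 2 ≤ 2 ^ (Nat.gcd k h) := Nat.pow_le_pow_right (by norm_num) hd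
    obtain ⟨p, hp, hpd⟩ := Nat.exists_prime_and_dvd (n := 2 ^ (Nat.gcd k h) - 1) (by omega)
    rw [← hgcd] at hpd
    haveI : Fact p.Prime := ⟨hp⟩
    obtain ⟨t, ht⟩ := exists_prime_orderOf_dvd_card' (G := Fˣ) p
      (by rw [hU]; exact hpd.trans (Nat.gcd_dvd_right _ _))
    have ht1 : t ≠ 1 := by
      rintro rfl
      rw [orderOf_one] at ht
      exact hp.one_lt.ne ht
    have htk : t ^ (2 ^ k - 1) = 1 :=
      orderOf_dvd_iff_pow_eq_one.1 (by rw [ht]; exact hpd.trans (Nat.gcd_dvd_left _ _))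
    have htk2 : (t : F) ^ (2 ^ k) = t := by
      have : t ^ (2 ^ k) = t := by
        rw [← Nat.sub_add_cancel hk1, pow_succ, htk, one_mul]
      exact_mod_cast congrArg Units.val this
    refine hdet 0 1 t zero_ne_one t.ne_zero.symm (fun e => ht1 (Units.ext e.symm)) ?_
    rw [Matrix.det_fin_three]
    simp [htk2]
  · intro hc
    have hc' : Nat.gcd k h = 1 := hc
    rw [hc'] at hgcd
    refine ⟨?_, ?_, ?_, ?_, ?_⟩
    · rw [natDegree_X_pow, hq]; exact hle
    · apply Finite.injective_iff_bijective.1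
      intro x y hxy
      simp only [eval_pow, eval_X] at hxy
      exact iterateFrobenius_inj F 2 k (by simpa [iterateFrobenius_def] using hxy)
    · simp
    · simp
    · intro a b c hab hac hbc hdet
      rw [Matrix.det_fin_three] at hdet
      simp only [eval_pow, eval_X] at hdet
      simp at hdet
      have hu : b - a ≠ 0 := sub_ne_zero.2 hab.symm
      have hv : c - a ≠ 0 := sub_ne_zero.2 hac.symm
      have e : (b - a) * (c - a) ^ (2 ^ k) = (c - a) * (b - a) ^ (2 ^ k) := by
        rw [sub_pow_char_pow, sub_pow_char_pow]
        linear_combination hdet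
      set t := Units.mk0 (c - a) hv / Units.mk0 (b - a) hu with ht
      have e2 : t ^ (2 ^ k - 1) = 1 := by
        have : t ^ (2 ^ k) = t := by
          ext
          simp only [ht, Units.val_pow_eq_pow_val, Units.val_div_eq_div_val, Units.val_mk0, div_pow]
          rw [div_eq_div_iff (pow_ne_zero _ hu) hu]
          linear_combination e
        rw [← Nat.sub_add_cancel hk1, pow_succ] at this
        exact mul_eq_right.1 this
      have e3 : t ^ (2 ^ h - 1) = 1 := by rw [← hU]; exact pow_card_eq_one'
      have e4 := Nat.dvd_gcd (orderOf_dvd_of_pow_eq_one e2) (orderOf_dvd_of_pow_eq_one e3)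
      rw [hgcd] at e4
      have e5 : t = 1 := orderOf_eq_one_iff.1 (Nat.dvd_one.1 (by simpa using e4))
      have e6 : c - a = b - a := by
        have := congrArg Units.val (div_eq_one.1 e5)
        simpa using this
      exact hbc (sub_left_injective e6).symm
end
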